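/- There exists a constant C > 0 such that the following holds. For every finite set A ⊆ ℝ² with |A| = m ≥ 2, every finite set B ⊆ ℝ² with |B| = n ≥ 2, and all real numbers 0 ≤ α < β, there exists a finite collection Γ = {(A_t, B_t)} of pairs of sets with A_t ⊆ A and B_t ⊆ B such that: the product sets A_t × B_t are pairwise disjoint; for every member (A_t, B_t) of Γ and every a ∈ A_t, b ∈ B_t the Euclidean distance ‖a − b‖ lies in (α, β]; every pair (a, b) ∈ A × B with ‖a − b‖ ∈ (α, β] belongs to A_t × B_t for exactly one member of Γ; and moreover |Γ| ≤ C^{log*(m+n)}·m^{2/3}·n^{2/3} + C·(m + n) and Σ_t |A_t| + Σ_t |B_t| ≤ C^{log*(m+n)}·m^{2/3}·n^{2/3} + C·(m·log₂ n + n·log₂ m). -/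

import Mathlib

/-- Points of the plane. -/
abbrev Pt : Type := EuclideanSpace ℝ (Fin 2)

/-- The iterated logarithm `log*` of a real number: the least nonnegative integer `k`
such that applying the base-2 logarithm `k` times yields a value at most `2`. -/
noncomputable def logStar (x : ℝ) : ℕ :=
  sInf {k : ℕ | (Real.logb 2)^[k] x ≤ 2}

def BicliqueCover {V : Type*} (R : V → V → Prop) (c s : ℝ) : Prop :=
  ∃ Γ : Finset (Finset V × Finset V),
    (∀ p ∈ Γ, ∀ q ∈ Γ, p ≠ q → Disjoint (p.1 ×ˢ p.2) (q.1 ×ˢ q.2)) ∧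
    (∀ a b, R a b ↔ ∃ p ∈ Γ, a ∈ p.1 ∧ b ∈ p.2) ∧
    (Γ.card : ℝ) ≤ c ∧ ∑ p ∈ Γ, ((p.1.card : ℝ) + (p.2.card : ℝ)) ≤ s

namespace BicliqueCover

variable {V : Type*} {R R₁ R₂ : V → V → Prop} {c s c₁ c₂ s₁ s₂ : ℝ}

theorem mono (h : BicliqueCover R c₁ s₁) (hc : c₁ ≤ c₂) (hs : s₁ ≤ s₂) :
    BicliqueCover R c₂ s₂ := by
  obtain ⟨Γ, h1, h2, h3, h4⟩ := h
  exact ⟨Γ, h1, h2, h3.trans hc, h4.trans hs⟩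

theorem congr (h : BicliqueCover R₁ c s) (hR : ∀ a b, R₂ a b ↔ R₁ a b) :
    BicliqueCover R₂ c s := by
  obtain ⟨Γ, h1, h2, h3, h4⟩ := h
  exact ⟨Γ, h1, fun a b => (hR a b).trans (h2 a b), h3, h4⟩

theorem empty (hR : ∀ a b, ¬ R a b) : BicliqueCover R 0 0 :=
  ⟨∅, by simp, by simpa using hR, by simp, by simp⟩

theorem rectangle (X Y : Finset V) :
    BicliqueCover (fun a b => a ∈ X ∧ b ∈ Y) 1 ((X.card : ℝ) + (Y.card : ℝ)) :=
  ⟨{(X, Y)}, by simp, by simp, by simp, by simp⟩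

theorem swap (h : BicliqueCover R c s) : BicliqueCover (fun a b => R b a) c s := by
  obtain ⟨Γ, h1, h2, h3, h4⟩ := h
  refine ⟨Γ.map (Equiv.prodComm _ _).toEmbedding, ?_, ?_, by simpa using h3, ?_⟩
  · simp only [Finset.mem_map_equiv]
    intro p hp q hq hpq
    have := h1 _ hp _ hq (by simpa using hpq)
    rw [Finset.disjoint_left] at this ⊢
    intro x hx hx'
    rw [Finset.mem_product] at hx hx'
    exact this (a := (x.2, x.1)) (Finset.mem_product.2 ⟨hx.2, hx.1⟩)
      (Finset.mem_product.2 ⟨hx'.2, hx'.1⟩)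
  · intro a b
    refine (h2 b a).trans ?_
    constructor
    · rintro ⟨p, hp, hb, ha⟩
      exact ⟨(p.2, p.1), by simpa using hp, ha, hb⟩
    · rintro ⟨p, hp, ha, hb⟩
      exact ⟨(p.2, p.1), by rw [Finset.mem_map_equiv] at hp; exact hp, hb, ha⟩
  · rw [Finset.sum_map]
    simpa [add_comm] using h4

theorem add (h₁ : BicliqueCover R₁ c₁ s₁) (h₂ : BicliqueCover R₂ c₂ s₂)
    (hd : ∀ a b, R₁ a b → ¬ R₂ a b) :
    BicliqueCover (fun a b => R₁ a b ∨ R₂ a b) (c₁ + c₂) (s₁ + s₂) := by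
  classical
  obtain ⟨Γ, h1, h2, h3, h4⟩ := h₁
  obtain ⟨Δ, k1, k2, k3, k4⟩ := h₂
  have cross : ∀ p ∈ Γ, ∀ q ∈ Δ, Disjoint (p.1 ×ˢ p.2) (q.1 ×ˢ q.2) := by
    intro p hp q hq
    rw [Finset.disjoint_left]
    rintro ⟨a, b⟩ hx hx'
    rw [Finset.mem_product] at hx hx'
    exact hd a b ((h2 a b).2 ⟨p, hp, hx⟩) ((k2 a b).2 ⟨q, hq, hx'⟩)
  refine ⟨Γ ∪ Δ, ?_, ?_, ?_, ?_⟩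
  · intro p hp q hq hpq
    rcases Finset.mem_union.1 hp with hp | hp <;> rcases Finset.mem_union.1 hq with hq | hq
    · exact h1 p hp q hq hpq
    · exact cross p hp q hq
    · exact (cross q hq p hp).symm
    · exact k1 p hp q hq hpq
  · intro a b
    simp only [h2, k2, Finset.mem_union, or_and_right, exists_or]
  · have : ((Γ ∪ Δ).card : ℝ) ≤ Γ.card + Δ.card := by exact_mod_cast Finset.card_union_le Γ Δ
    linarith
  · have := Finset.sum_union_inter (s₁ := Γ) (s₂ := Δ)
      (f := fun p : Finset V × Finset V => ((p.1.card : ℝ) + (p.2.card : ℝ)))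
    have h0 : 0 ≤ ∑ p ∈ Γ ∩ Δ, ((p.1.card : ℝ) + (p.2.card : ℝ)) :=
      Finset.sum_nonneg fun _ _ => by positivity
    linarith

theorem biUnion {ι : Type*} (t : Finset ι) (S : ι → V → V → Prop) (c s : ι → ℝ)
    (h : ∀ i ∈ t, BicliqueCover (S i) (c i) (s i))
    (hd : ∀ i ∈ t, ∀ j ∈ t, ∀ a b, S i a b → S j a b → i = j) :
    BicliqueCover (fun a b => ∃ i ∈ t, S i a b) (∑ i ∈ t, c i) (∑ i ∈ t, s i) := by
  classical
  induction t using Finset.induction_on with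
  | empty => simpa using empty (R := fun _ _ : V => False) (by simp)
  | insert i t hi ih =>
    rw [Finset.sum_insert hi, Finset.sum_insert hi]
    refine ((h i (Finset.mem_insert_self i t)).add
      (ih (fun j hj => h j (Finset.mem_insert_of_mem hj))
        (fun j hj k hk => hd j (Finset.mem_insert_of_mem hj) k (Finset.mem_insert_of_mem hk)))
      ?_).congr ?_
    · rintro a b hab ⟨j, hj, hjab⟩
      exact hi (hd i (Finset.mem_insert_self i t) j (Finset.mem_insert_of_mem hj) a b hab hjab ▸ hj)
    · simp

end BicliqueCover

theorem exists_small_blocks {V : Type*} [DecidableEq V] (s : ℕ) (hs : 1 ≤ s) (X : Finset V) :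
    ∃ ρ : V → V, (∀ x ∈ X, ρ x ∈ X) ∧ (∀ q, (X.filter (fun x => ρ x = q)).card ≤ s) ∧
      ((X.image ρ).card : ℝ) ≤ (X.card : ℝ) / s + 1 := by
  induction X using Finset.strongInduction with
  | H X ih =>
    have hs0 : (0 : ℝ) < s := by exact_mod_cast hs
    rcases le_or_gt X.card s with hX | hX
    · rcases X.eq_empty_or_nonempty with rfl | ⟨y, hy⟩
      · exact ⟨id, by simp, by simp, by simp⟩
      · refine ⟨fun _ => y, fun _ _ => hy, fun q => (Finset.card_filter_le _ _).trans hX, ?_⟩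
        have h1 : (X.image fun _ => y).card ≤ 1 := by
          rw [Finset.image_const ⟨y, hy⟩]; simp
        have h2 : ((X.image fun _ => y).card : ℝ) ≤ 1 := by exact_mod_cast h1
        have : 0 ≤ (X.card : ℝ) / s := by positivity
        linarith
    · obtain ⟨Y, hYX, hYs⟩ := Finset.exists_subset_card_eq hX.le
      have hYne : Y.Nonempty := by rw [← Finset.card_pos]; omega
      obtain ⟨y, hy⟩ := hYne
      obtain ⟨ρ, h1, h2, h3⟩ := ih (X \ Y) (Finset.sdiff_ssubset hYX ⟨y, hy⟩)
      refine ⟨fun x => if x ∈ Y then y else ρ x, ?_, ?_, ?_⟩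
      · intro x hx
        by_cases hxY : x ∈ Y
        · simpa [hxY] using hYX hy
        · simpa [hxY] using (Finset.mem_sdiff.1 (h1 x (Finset.mem_sdiff.2 ⟨hx, hxY⟩))).1
      · intro q
        by_cases hq : q ∈ Y
        · refine (Finset.card_le_card ?_).trans hYs.le
          intro x hx
          rw [Finset.mem_filter] at hx
          beta_reduce at hx
          by_contra hxY
          rw [if_neg hxY] at hx
          have := h1 x (Finset.mem_sdiff.2 ⟨hx.1, hxY⟩)
          rw [hx.2] at this
          exact (Finset.mem_sdiff.1 this).2 hq
        · refine (Finset.card_le_card ?_).trans (h2 q)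
          intro x hx
          rw [Finset.mem_filter] at hx ⊢
          beta_reduce at hx
          by_cases hxY : x ∈ Y
          · rw [if_pos hxY] at hx
            exact absurd (hx.2 ▸ hy) hq
          · rw [if_neg hxY] at hx
            exact ⟨Finset.mem_sdiff.2 ⟨hx.1, hxY⟩, hx.2⟩
      · have h4 : X.image (fun x => if x ∈ Y then y else ρ x) ⊆ insert y ((X \ Y).image ρ) := by
          intro z hz
          obtain ⟨x, hx, rfl⟩ := Finset.mem_image.1 hz
          by_cases hxY : x ∈ Y
          · simp [hxY]
          · rw [if_neg hxY]
            exact Finset.mem_insert_of_mem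
              (Finset.mem_image_of_mem _ (Finset.mem_sdiff.2 ⟨hx, hxY⟩))
        have h5 := (Finset.card_le_card h4).trans (Finset.card_insert_le _ _)
        have h6 : ((X.image (fun x => if x ∈ Y then y else ρ x)).card : ℝ)
            ≤ ((X \ Y).image ρ).card + 1 := by exact_mod_cast h5
        have h7 : ((X \ Y).card : ℝ) = X.card - s := by
          rw [Finset.card_sdiff_of_subset hYX, hYs, Nat.cast_sub hX.le]
        rw [h7, sub_div, div_self hs0.ne'] at h3
        linarith

theorem exists_refinement {V : Type*} [DecidableEq V] (A : Finset V) (par : V → V) (s : ℕ)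
    (hs : 1 ≤ s) :
    ∃ par' : V → V, (∀ a ∈ A, par' a ∈ A ∧ par (par' a) = par a) ∧
      (∀ q, (A.filter (fun x => par' x = q)).card ≤ s) ∧
      ∀ g : V → ℝ, (∀ q, 0 ≤ g q) → ∑ i ∈ A.image par', g (par i) ≤
        ∑ q ∈ A.image par, g q * (((A.filter (fun x => par x = q)).card : ℝ) / s + 1) := by
  choose ρ h1 h2 h3 using exists_small_blocks (V := V) s hs
  have hfib : ∀ a ∈ A, a ∈ A.filter (fun x => par x = par a) := fun a ha => by simp [ha]
  have hpar : ∀ a ∈ A, ρ (A.filter (fun x => par x = par a)) a ∈ A ∧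
      par (ρ (A.filter (fun x => par x = par a)) a) = par a := fun a ha => by
    simpa using h1 _ a (hfib a ha)
  refine ⟨fun a => ρ (A.filter (fun x => par x = par a)) a, hpar, ?_, ?_⟩
  · intro q
    refine (Finset.card_le_card ?_).trans (h2 (A.filter (fun x => par x = par q)) q)
    intro x hx
    rw [Finset.mem_filter] at hx
    beta_reduce at hx
    have h := (hpar x hx.1).2
    rw [hx.2] at h
    simp only [Finset.mem_filter]
    refine ⟨⟨hx.1, h.symm⟩, ?_⟩
    rw [h]; exact hx.2
  · intro g hg
    rw [← Finset.sum_fiberwise_of_maps_to (s := A.image _) (t := A.image par) (g := par)]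
    · refine Finset.sum_le_sum fun q hq => ?_
      have : ∀ i ∈ (A.image fun a => ρ (A.filter (fun x => par x = par a)) a).filter
          (fun i => par i = q), g (par i) = g q := by
        intro i hi
        rw [(Finset.mem_filter.1 hi).2]
      rw [Finset.sum_congr rfl this, Finset.sum_const, nsmul_eq_mul, mul_comm]
      refine mul_le_mul_of_nonneg_left (le_trans ?_ (h3 _)) (hg q)
      norm_cast
      refine Finset.card_le_card ?_
      intro i hi
      rw [Finset.mem_filter, Finset.mem_image] at hi
      obtain ⟨⟨a, ha, rfl⟩, hi⟩ := hi
      rw [(hpar a ha).2] at hi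
      subst hi
      exact Finset.mem_image_of_mem _ (hfib a ha)
    · intro i hi
      obtain ⟨a, ha, rfl⟩ := Finset.mem_image.1 hi
      rw [(hpar a ha).2]
      exact Finset.mem_image_of_mem _ ha

def HasCuttings {V : Type*} [DecidableEq V] (rel : V → V → Prop) (C : ℝ) : Prop :=
  ∀ (A B : Finset V) (r : ℝ), 1 ≤ r → r ≤ B.card →
    ∃ (par : V → V) (I : V → Finset V), (∀ a ∈ A, par a ∈ A) ∧ (∀ q, I q ⊆ B) ∧
      (∀ a ∈ A, ∀ b ∈ B, b ∉ I (par a) → (rel a b ↔ rel (par a) b)) ∧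
      ((A.image par).card : ℝ) ≤ C * r ^ 2 ∧
      (∑ q ∈ A.image par, ((I q).card : ℝ) ^ 2) ≤ C * (B.card : ℝ) ^ 2 ∧
      ∀ q ∈ A.image par, ((I q).card : ℝ) ≤ C * (B.card / r) * (1 + Real.log r)

theorem HasCuttings.exists_halving {V : Type*} [DecidableEq V] {rel : V → V → Prop} {C : ℝ}
    (h : HasCuttings rel C) (hC : 1 ≤ C) (P B : Finset V) (r : ℝ) (hr : 1 ≤ r)
    (hrB : r ≤ B.card) (hP : 4 * C ≤ P.card) (hPr : (P.card : ℝ) ≤ C * r ^ 2) :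
    ∃ (par : V → V) (J : V → Finset V), (∀ p ∈ P, par p ∈ P) ∧ (∀ q, J q ⊆ B) ∧
      (∀ p ∈ P, ∀ b ∈ B, b ∉ J (par p) → (rel p b ↔ rel (par p) b)) ∧
      (∀ q, (P.filter (fun x => par x = q)).card ≤ 4) ∧
      ((P.image par).card : ℝ) ≤ (P.card : ℝ) / 2 ∧
      (∑ q ∈ P.image par, ((J q).card : ℝ)) ≤ 4 * C ^ 2 * B.card * r * (1 + Real.log r) := by
  set N : ℝ := (P.card : ℝ) with hN
  have hC0 : 0 < C := by linarith
  set ρ := Real.sqrt (N / (4 * C)) with hρ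
  have hρ2 : ρ ^ 2 = N / (4 * C) := Real.sq_sqrt (by positivity)
  have hNρ : N = 4 * C * ρ ^ 2 := by rw [hρ2]; field_simp
  have hρ1 : 1 ≤ ρ := by
    rw [hρ, Real.one_le_sqrt, le_div_iff₀ (by positivity)]; linarith
  clear_value ρ
  clear hρ
  have hρr : ρ ≤ r := by
    have : ρ ^ 2 ≤ r ^ 2 := by
      rw [hNρ] at hPr
      have h0 : 0 ≤ ρ ^ 2 := by positivity
      have := mul_le_mul_of_nonneg_left hPr (inv_nonneg.2 hC0.le)
      field_simp at this
      nlinarith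
    exact le_of_sq_le_sq this (by linarith)
  obtain ⟨par, I, h1, h2, h3, h4, h5, h6⟩ := h P B ρ hρ1 (hρr.trans hrB)
  obtain ⟨par', k1, k2, k3⟩ := exists_refinement P par 4 (by norm_num)
  have hcard : ((P.image par').card : ℝ) ≤ N / 2 := by
    have := k3 (fun _ => 1) (fun _ => zero_le_one)
    simp only [Finset.sum_const, nsmul_eq_mul, mul_one, one_mul, Finset.sum_add_distrib,
      ← Finset.sum_div] at this
    rw [← Nat.cast_sum, ← Finset.card_eq_sum_card_image, ← hN] at this
    push_cast at this
    rw [hρ2] at h4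
    have h7 : C * (N / (4 * C)) = N / 4 := by field_simp
    linarith
  refine ⟨par', fun q => I (par q), fun p hp => (k1 p hp).1, fun q => h2 _, ?_, k2, hcard, ?_⟩
  · intro p hp b hb hbI
    beta_reduce at hbI
    rw [(k1 p hp).2] at hbI
    rw [h3 p hp b hb hbI, h3 (par' p) (k1 p hp).1 b hb (by rwa [(k1 p hp).2]), (k1 p hp).2]
  · have hb : ∀ q ∈ P.image par',
        ((I (par q)).card : ℝ) ≤ C * (B.card / ρ) * (1 + Real.log ρ) := by
      intro q hq
      obtain ⟨p, hp, rfl⟩ := Finset.mem_image.1 hq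
      rw [(k1 p hp).2]
      exact h6 _ (Finset.mem_image_of_mem _ hp)
    refine (Finset.sum_le_sum hb).trans ?_
    rw [Finset.sum_const, nsmul_eq_mul]
    have hlog : Real.log ρ ≤ Real.log r := Real.log_le_log (by linarith) hρr
    have hlog0 : 0 ≤ Real.log ρ := Real.log_nonneg hρ1
    have e1 : ((P.image par').card : ℝ) ≤ 4 * C * ρ ^ 2 := by rw [← hNρ]; linarith [Nat.cast_nonneg (α := ℝ) P.card]
    clear hNρ hρ2
    calc ((P.image par').card : ℝ) * (C * (B.card / ρ) * (1 + Real.log ρ))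
        ≤ (4 * C * ρ ^ 2) * (C * (B.card / ρ) * (1 + Real.log ρ)) := by gcongr
      _ = 4 * C ^ 2 * B.card * ρ * (1 + Real.log ρ) := by field_simp
      _ ≤ _ := by gcongr

theorem BicliqueCover.rectangles {V : Type*} [DecidableEq V] (P : Finset V) (T Y : V → Finset V)
    (hT : ∀ p ∈ P, ∀ q ∈ P, p ≠ q → Disjoint (T p) (T q)) :
    BicliqueCover (fun a b => ∃ p ∈ P, a ∈ T p ∧ b ∈ Y p) P.card
      (∑ p ∈ P, ((T p).card + (Y p).card : ℝ)) := by
  have := BicliqueCover.biUnion P (fun p a b => a ∈ T p ∧ b ∈ Y p) (fun _ => 1)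
    (fun p => ((T p).card + (Y p).card : ℝ)) (fun p _ => BicliqueCover.rectangle _ _) ?_
  · simpa using this
  · intro p hp q hq a b h1 h2
    by_contra hpq
    exact Finset.disjoint_left.1 (hT p hp q hq hpq) h1.1 h2.1

theorem HasCuttings.hierarchy {V : Type*} [DecidableEq V] {rel : V → V → Prop} {C : ℝ}
    (h : HasCuttings rel C) (hC : 1 ≤ C) (B : Finset V) (r : ℝ) (hr : 1 ≤ r)
    (hrB : r ≤ B.card) (j : ℕ) : ∀ (P : Finset V) (T X : V → Finset V),
      (∀ p ∈ P, ∀ q ∈ P, p ≠ q → Disjoint (T p) (T q)) →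
      (∀ p ∈ P, ∀ a ∈ T p, ∀ b ∈ B, b ∉ X p → (rel a b ↔ rel p b)) →
      (P.card : ℝ) ≤ 4 * C * 2 ^ j → (P.card : ℝ) ≤ C * r ^ 2 →
      BicliqueCover (fun a b => ∃ p ∈ P, a ∈ T p ∧ b ∈ B ∧ b ∉ X p ∧ rel a b) (2 * P.card)
        ((j + 1) * (∑ p ∈ P, ((T p).card : ℝ) + 4 * ∑ p ∈ P, ((X p).card : ℝ) +
          4 * (j + 1) * (4 * C ^ 2 * B.card * r * (1 + Real.log r)))) := by
  classical
  have hlog : 0 ≤ Real.log r := Real.log_nonneg hr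
  set Δ : ℝ := 4 * C ^ 2 * B.card * r * (1 + Real.log r) with hΔ
  have hΔ0 : 0 ≤ Δ := by positivity
  have hΔB : C * B.card ≤ Δ := by
    calc C * (B.card : ℝ) = C * B.card * 1 * (1 + 0) := by ring
      _ ≤ (4 * C ^ 2) * B.card * r * (1 + Real.log r) := by gcongr; nlinarith
  have base : ∀ (P : Finset V) (T X : V → Finset V),
      (∀ p ∈ P, ∀ q ∈ P, p ≠ q → Disjoint (T p) (T q)) →
      (∀ p ∈ P, ∀ a ∈ T p, ∀ b ∈ B, b ∉ X p → (rel a b ↔ rel p b)) →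
      (P.card : ℝ) ≤ 4 * C →
      BicliqueCover (fun a b => ∃ p ∈ P, a ∈ T p ∧ b ∈ B ∧ b ∉ X p ∧ rel a b) (2 * P.card)
        (∑ p ∈ P, ((T p).card : ℝ) + 4 * Δ) := by
    intro P T X hT hinv hP
    refine ((BicliqueCover.rectangles P T (fun p => B.filter (fun b => b ∉ X p ∧ rel p b))
      hT).congr ?_).mono ?_ ?_
    · intro a b
      refine exists_congr fun p => and_congr_right fun hp => and_congr_right fun ha => ?_
      rw [Finset.mem_filter]
      refine and_congr_right fun hb => and_congr_right fun hX => ?_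
      exact hinv p hp a ha b hb hX
    · have : (0 : ℝ) ≤ P.card := by positivity
      linarith
    · rw [Finset.sum_add_distrib]
      have h1 : ∑ p ∈ P, ((B.filter (fun b => b ∉ X p ∧ rel p b)).card : ℝ) ≤
          ∑ p ∈ P, (B.card : ℝ) := Finset.sum_le_sum fun p _ => by
        exact_mod_cast Finset.card_filter_le _ _
      rw [Finset.sum_const, nsmul_eq_mul] at h1
      have h2 : (P.card : ℝ) * B.card ≤ 4 * C * B.card := by gcongr
      linarith
  induction j with
  | zero =>
    intro P T X hT hinv hP _
    refine (base P T X hT hinv (by simpa using hP)).mono le_rfl ?_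
    have : 0 ≤ ∑ p ∈ P, ((X p).card : ℝ) := Finset.sum_nonneg fun _ _ => by positivity
    push_cast
    linarith
  | succ j ih =>
    intro P T X hT hinv hP hPr
    have hM0 : 0 ≤ ∑ p ∈ P, ((T p).card : ℝ) := Finset.sum_nonneg fun _ _ => by positivity
    have hX0 : 0 ≤ ∑ p ∈ P, ((X p).card : ℝ) := Finset.sum_nonneg fun _ _ => by positivity
    have hj0 : (0 : ℝ) ≤ j := by positivity
    rcases le_or_gt (P.card : ℝ) (4 * C) with hP4 | hP4
    · refine (base P T X hT hinv hP4).mono le_rfl ?_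
      push_cast
      nlinarith [mul_nonneg hj0 hM0, mul_nonneg hj0 hX0, mul_nonneg hj0 hΔ0,
        mul_nonneg (mul_nonneg hj0 hj0) hΔ0]
    obtain ⟨par, J, h1, h2, h3, h4, h5, h6⟩ := h.exists_halving hC P B r hr hrB hP4.le hPr
    set T' : V → Finset V := fun q => (P.filter (fun p => par p = q)).biUnion T with hT'
    set X' : V → Finset V := fun q => J q ∪ (P.filter (fun p => par p = q)).biUnion X with hX'
    have memT : ∀ q a, a ∈ T' q ↔ ∃ p ∈ P, par p = q ∧ a ∈ T p := by
      intro q a; simp [hT', and_assoc]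
    have memX : ∀ q b, b ∈ X' q ↔ b ∈ J q ∨ ∃ p ∈ P, par p = q ∧ b ∈ X p := by
      intro q a; simp [hX', and_assoc]
    have hTeq : ∀ p ∈ P, ∀ q ∈ P, ∀ a, a ∈ T p → a ∈ T q → p = q := by
      intro p hp q hq a hap haq
      by_contra hpq
      exact Finset.disjoint_left.1 (hT p hp q hq hpq) hap haq
    have fib : ∀ (F : V → Finset V), ∑ q ∈ P.image par,
        (((P.filter (fun p => par p = q)).biUnion F).card : ℝ) ≤ ∑ p ∈ P, ((F p).card : ℝ) := by
      intro F
      rw [← Finset.sum_fiberwise_of_maps_to (s := P) (t := P.image par) (g := par)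
        (fun p hp => Finset.mem_image_of_mem _ hp)]
      refine Finset.sum_le_sum fun q _ => ?_
      exact_mod_cast Finset.card_biUnion_le
    have hX's : ∑ q ∈ P.image par, ((X' q).card : ℝ) ≤ Δ + ∑ p ∈ P, ((X p).card : ℝ) := by
      refine le_trans ?_ (add_le_add h6 (fib X))
      rw [← Finset.sum_add_distrib]
      refine Finset.sum_le_sum fun q _ => ?_
      exact_mod_cast Finset.card_union_le _ _
    have hI := ih (P.image par) T' X' ?_ ?_ ?_ ?_
    · have hL := BicliqueCover.rectangles P T
        (fun p => (X' (par p)).filter (fun b => b ∈ B ∧ b ∉ X p ∧ rel p b)) hT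
      refine ((hL.add hI ?_).congr ?_).mono ?_ ?_
      · rintro a b ⟨p, hp, ha, hb⟩ ⟨q, hq, ha', _, hb', _⟩
        obtain ⟨p', hp', rfl, hap'⟩ := (memT q a).1 ha'
        obtain rfl := hTeq p hp p' hp' a ha hap'
        exact hb' (Finset.mem_filter.1 hb).1
      · intro a b
        constructor
        · rintro ⟨p, hp, ha, hb, hbX, hab⟩
          by_cases hb' : b ∈ X' (par p)
          · exact Or.inl ⟨p, hp, ha, Finset.mem_filter.2
              ⟨hb', hb, hbX, (hinv p hp a ha b hb hbX).1 hab⟩⟩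
          · exact Or.inr ⟨par p, Finset.mem_image_of_mem _ hp,
              (memT _ _).2 ⟨p, hp, rfl, ha⟩, hb, hb', hab⟩
        · rintro (⟨p, hp, ha, hb⟩ | ⟨q, hq, ha, hb, hbX, hab⟩)
          · obtain ⟨_, hb, hbX, hab⟩ := Finset.mem_filter.1 hb
            exact ⟨p, hp, ha, hb, hbX, (hinv p hp a ha b hb hbX).2 hab⟩
          · obtain ⟨p, hp, rfl, hap⟩ := (memT q a).1 ha
            exact ⟨p, hp, hap, hb, fun hbp => hbX ((memX _ _).2 (Or.inr ⟨p, hp, rfl, hbp⟩)), hab⟩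
      · linarith
      · have e1 : ∑ p ∈ P, (((T p).card : ℝ) +
            ((X' (par p)).filter (fun b => b ∈ B ∧ b ∉ X p ∧ rel p b)).card) ≤
            ∑ p ∈ P, ((T p).card : ℝ) + 4 * ∑ q ∈ P.image par, ((X' q).card : ℝ) := by
          rw [Finset.sum_add_distrib]
          refine add_le_add le_rfl ?_
          rw [← Finset.sum_fiberwise_of_maps_to (s := P) (t := P.image par) (g := par)
            (fun p hp => Finset.mem_image_of_mem _ hp), Finset.mul_sum]
          refine Finset.sum_le_sum fun q _ => ?_
          have e2 : ∀ p ∈ P.filter (fun p => par p = q),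
              (((X' (par p)).filter (fun b => b ∈ B ∧ b ∉ X p ∧ rel p b)).card : ℝ) ≤
                (X' q).card := by
            intro p hp
            rw [(Finset.mem_filter.1 hp).2]
            exact_mod_cast Finset.card_filter_le _ _
          refine (Finset.sum_le_sum e2).trans ?_
          rw [Finset.sum_const, nsmul_eq_mul]
          have : ((P.filter (fun p => par p = q)).card : ℝ) ≤ 4 := by exact_mod_cast h4 q
          gcongr
        have e3 := fib T
        have e4 : ((j : ℝ) + 1) * (∑ q ∈ P.image par, ((T' q).card : ℝ) +
            4 * ∑ q ∈ P.image par, ((X' q).card : ℝ) + 4 * (j + 1) * Δ) ≤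
            (j + 1) * (∑ p ∈ P, ((T p).card : ℝ) + 4 * (Δ + ∑ p ∈ P, ((X p).card : ℝ)) +
              4 * (j + 1) * Δ) := by gcongr
        push_cast
        nlinarith [mul_nonneg hj0 hΔ0, mul_nonneg (mul_nonneg hj0 hj0) hΔ0]
    · intro p hp q hq hpq
      rw [Finset.disjoint_left]
      intro a ha ha'
      obtain ⟨p1, hp1, rfl, h1a⟩ := (memT _ _).1 ha
      obtain ⟨p2, hp2, rfl, h2a⟩ := (memT _ _).1 ha'
      exact hpq (by rw [hTeq p1 hp1 p2 hp2 a h1a h2a])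
    · intro q hq a ha b hb hbX
      obtain ⟨p, hp, rfl, hap⟩ := (memT _ _).1 ha
      rw [memX, not_or] at hbX
      exact (hinv p hp a hap b hb fun hbp => hbX.2 ⟨p, hp, rfl, hbp⟩).trans
        (h3 p hp b hb hbX.1)
    · rw [pow_succ] at hP
      linarith
    · have : (0 : ℝ) ≤ P.card := by positivity
      linarith

theorem hierarchy_size_le {C j m n r l S : ℝ} (hC : 1 ≤ C) (hj : 0 ≤ j) (hm : 0 ≤ m)
    (hZ : 0 ≤ n * r) (hl : 1 ≤ l) (hS0 : 0 ≤ S) (hS : S ≤ C * n * r) (hjl : j + 1 ≤ 3 * l) :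
    (j + 1) * (m + 4 * S + 4 * (j + 1) * (4 * C ^ 2 * n * r * l)) ≤
      156 * C ^ 2 * (m * l + n * r * l ^ 3) := by
  have hCC : C ≤ C ^ 2 := le_self_pow₀ hC (by norm_num)
  have h1C : 1 ≤ C ^ 2 := hC.trans hCC
  have hl3 : l ≤ l ^ 3 := le_self_pow₀ hl (by norm_num)
  have hl0 : 0 ≤ l := by linarith
  have a1 : (j + 1) * (m + 4 * S + 4 * (j + 1) * (4 * C ^ 2 * n * r * l)) ≤
      (3 * l) * (m + 4 * (C * n * r) + 4 * (3 * l) * (4 * C ^ 2 * n * r * l)) := by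
    have : 0 ≤ 4 * C ^ 2 * n * r * l := by
      have : 0 ≤ 4 * C ^ 2 * (n * r) * l := by positivity
      linarith
    have : 0 ≤ C * n * r := hS0.trans hS
    gcongr
  have a2 : C * (n * r * l) ≤ C ^ 2 * (n * r * l ^ 3) := by gcongr
  have a3 : 1 * (m * l) ≤ C ^ 2 * (m * l) := by gcongr
  have a4 : 0 ≤ C ^ 2 * (m * l) := by positivity
  linear_combination a1 + 12 * a2 + 3 * a3 + 153 * a4

theorem HasCuttings.exists_partition {V : Type*} [DecidableEq V] {rel : V → V → Prop} {C : ℝ}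
    (h : HasCuttings rel C) (hC : 1 ≤ C) (A B : Finset V) (r : ℝ) (hr : 1 ≤ r)
    (hrB : r ≤ B.card) :
    ∃ (par : V → V) (I : V → Finset V), (∀ a ∈ A, par a ∈ A) ∧ (∀ q, I q ⊆ B) ∧
      ((A.image par).card : ℝ) ≤ C * r ^ 2 ∧
      (∑ q ∈ A.image par, ((I q).card : ℝ) ^ 2) ≤ C * (B.card : ℝ) ^ 2 ∧
      (∑ q ∈ A.image par, ((I q).card : ℝ)) ≤ C * B.card * r ∧
      (∀ q ∈ A.image par, ((I q).card : ℝ) ≤ C * (B.card / r) * (1 + Real.log r)) ∧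
      BicliqueCover (fun a b => a ∈ A ∧ b ∈ B ∧ b ∉ I (par a) ∧ rel a b) (2 * C * r ^ 2)
        (156 * C ^ 2 * (A.card * (1 + Real.log r) + B.card * r * (1 + Real.log r) ^ 3)) := by
  obtain ⟨par, I, h1, h2, h3, h4, h5, h6⟩ := h A B r hr hrB
  have hlog : 0 ≤ Real.log r := Real.log_nonneg hr
  have hsum : ∑ q ∈ A.image par, ((I q).card : ℝ) ≤ C * B.card * r := by
    refine le_of_sq_le_sq ?_ (by positivity)
    calc (∑ q ∈ A.image par, ((I q).card : ℝ)) ^ 2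
        ≤ (A.image par).card * ∑ q ∈ A.image par, ((I q).card : ℝ) ^ 2 :=
          sq_sum_le_card_mul_sum_sq
      _ ≤ (C * r ^ 2) * (C * (B.card : ℝ) ^ 2) := by gcongr
      _ = _ := by ring
  refine ⟨par, I, h1, h2, h4, h5, hsum, h6, ?_⟩
  set j := ⌈2 * Real.log r / Real.log 2⌉₊ with hj
  have hl2 : 0 < Real.log 2 := Real.log_pos (by norm_num)
  have hjr : r ^ 2 ≤ 2 ^ j := by
    have e := Nat.le_ceil (2 * Real.log r / Real.log 2)
    rw [← hj, div_le_iff₀ hl2] at e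
    rw [← Real.log_le_log_iff (by positivity) (by positivity), Real.log_pow, Real.log_pow]
    exact_mod_cast e
  have hjl : (j : ℝ) + 1 ≤ 3 * (1 + Real.log r) := by
    have e := Nat.ceil_lt_add_one (a := 2 * Real.log r / Real.log 2) (by positivity)
    rw [← hj] at e
    have : 2 * Real.log r / Real.log 2 ≤ 3 * Real.log r := by
      rw [div_le_iff₀ hl2]
      nlinarith [Real.log_two_gt_d9]
    linarith
  have H := h.hierarchy hC B r hr hrB j (A.image par) (fun q => A.filter (fun a => par a = q)) I
    ?_ ?_ ?_ h4
  · refine (H.congr ?_).mono (by linarith) ?_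
    · intro a b
      constructor
      · rintro ⟨ha, hb, hI, hab⟩
        exact ⟨par a, Finset.mem_image_of_mem _ ha, by simp [ha], hb, hI, hab⟩
      · rintro ⟨q, hq, ha, hb, hI, hab⟩
        obtain ⟨haA, rfl⟩ := Finset.mem_filter.1 ha
        exact ⟨haA, hb, hI, hab⟩
    · have e1 : ∑ q ∈ A.image par, ((A.filter (fun a => par a = q)).card : ℝ) = A.card := by
        rw [← Nat.cast_sum, ← Finset.card_eq_sum_card_image]
      rw [e1]
      exact hierarchy_size_le hC (Nat.cast_nonneg _) (Nat.cast_nonneg _)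
        (mul_nonneg (Nat.cast_nonneg _) (by linarith)) (by linarith)
        (Finset.sum_nonneg fun _ _ => Nat.cast_nonneg _) hsum hjl
  · intro p _ q _ hpq
    rw [Finset.disjoint_left]
    intro a ha ha'
    exact hpq ((Finset.mem_filter.1 ha).2.symm.trans (Finset.mem_filter.1 ha').2)
  · intro q _ a ha b hb hI
    obtain ⟨haA, rfl⟩ := Finset.mem_filter.1 ha
    exact h3 a haA b hb hI
  · calc ((A.image par).card : ℝ) ≤ C * r ^ 2 := h4
      _ ≤ 4 * C * 2 ^ j := by gcongr; linarith

theorem mul_one_add_log_pow_le {r x l : ℝ} (hr : 1 ≤ r) (hrx : r ≤ max 1 x) (hx : 0 ≤ x)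
    (hl : 1 + Real.log r ≤ l) : r * (1 + Real.log r) ^ 3 ≤ 1 + x * l ^ 3 := by
  have hlog := Real.log_nonneg hr
  have hl0 : 0 ≤ l := by linarith
  rcases le_total x 1 with h | h
  · rw [max_eq_left h] at hrx
    obtain rfl : r = 1 := le_antisymm hrx hr
    have : 0 ≤ x * l ^ 3 := by positivity
    simpa using this
  · rw [max_eq_right h] at hrx
    have : r * (1 + Real.log r) ^ 3 ≤ x * l ^ 3 := by gcongr
    linarith

theorem HasCuttings.exists_coarse_partition {V : Type*} [DecidableEq V] {rel : V → V → Prop}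
    {C : ℝ} (h : HasCuttings rel C) (hC : 1 ≤ C) (A B : Finset V) {μ ν l : ℝ}
    (hA : (A.card : ℝ) = μ ^ 3) (hB : (B.card : ℝ) = ν ^ 3) (hμ : 1 ≤ μ) (hμν : μ ≤ ν)
    (hl : l = 1 + Real.log A.card) :
    ∃ (par : V → V) (I : V → Finset V) (r : ℝ), (∀ a ∈ A, par a ∈ A) ∧ (∀ q, I q ⊆ B) ∧
      1 ≤ r ∧ μ ^ 2 / (ν * l ^ 3) ≤ r ∧
      (∀ q, ((A.filter (fun a => par a = q)).card : ℝ) * r ^ 2 ≤ 2 * μ ^ 3 * l ^ 2) ∧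
      (∑ q ∈ A.image par, ((I q).card : ℝ) ^ 2) ≤ 2 * C ^ 2 * (ν ^ 3) ^ 2 ∧
      (∑ q ∈ A.image par, ((I q).card : ℝ)) ≤ 2 * C ^ 2 * (ν ^ 3 + μ ^ 2 * ν ^ 2 / l ^ 3) ∧
      BicliqueCover (fun a b => a ∈ A ∧ b ∈ B ∧ b ∉ I (par a) ∧ rel a b)
        (2 * C * (μ ^ 2 * ν ^ 2)) (156 * C ^ 2 * (μ ^ 3 * l + ν ^ 3 + μ ^ 2 * ν ^ 2)) := by
  have hν : 1 ≤ ν := hμ.trans hμν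
  have hμ0 : 0 < μ := by linarith
  have hν0 : 0 < ν := by linarith
  have hm1 : 1 ≤ μ ^ 3 := one_le_pow₀ hμ
  have hl1 : 1 ≤ l := by
    rw [hl, hA]
    linarith [Real.log_nonneg hm1]
  have hl0 : 0 < l := by linarith
  set x := μ ^ 2 / (ν * l ^ 3) with hx
  have hx0 : 0 ≤ x := by positivity
  have hxμ : x ≤ μ := by
    rw [hx, div_le_iff₀ (by positivity)]
    have : 1 ≤ l ^ 3 := one_le_pow₀ hl1
    calc μ ^ 2 = μ * (μ * 1) := by ring
      _ ≤ μ * (ν * l ^ 3) := by gcongr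
  set r := max 1 x with hr
  have hr1 : 1 ≤ r := le_max_left _ _
  have hrx : x ≤ r := le_max_right _ _
  have hrμ : r ≤ μ := max_le hμ hxμ
  have hrB : r ≤ B.card := by
    rw [hB]
    exact hrμ.trans (hμν.trans (le_self_pow₀ hν (by norm_num)))
  have hlr : 1 + Real.log r ≤ l := by
    rw [hl, hA]
    have : Real.log r ≤ Real.log (μ ^ 3) :=
      Real.log_le_log (by linarith) (hrμ.trans (le_self_pow₀ hμ (by norm_num)))
    linarith
  have hlog := Real.log_nonneg hr1
  have hrx1 : r ≤ 1 + x := max_le (by linarith) (by linarith)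
  obtain ⟨par, I, h1, h2, -, h4, h5, h6, h7⟩ := h.exists_partition hC A B r hr1 hrB
  have hy : 1 ≤ μ ^ 3 * l ^ 2 / r ^ 2 := by
    rw [le_div_iff₀ (by positivity)]
    calc 1 * r ^ 2 ≤ 1 * μ ^ 2 := by gcongr
      _ ≤ l ^ 2 * μ ^ 3 := by
        gcongr
        · exact one_le_pow₀ hl1
        norm_num
      _ = _ := by ring
  set s := ⌈μ ^ 3 * l ^ 2 / r ^ 2⌉₊ with hs
  have hs1 : 1 ≤ s := by
    rw [hs, Nat.one_le_ceil_iff]; linarith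
  have hsy : μ ^ 3 * l ^ 2 / r ^ 2 ≤ s := Nat.le_ceil _
  have hs2 : (s : ℝ) ≤ 2 * (μ ^ 3 * l ^ 2 / r ^ 2) := by
    have := Nat.ceil_lt_add_one (a := μ ^ 3 * l ^ 2 / r ^ 2) (by linarith)
    linarith
  have hs0 : (0 : ℝ) < s := by linarith
  obtain ⟨par', k1, k2, k3⟩ := exists_refinement A par s hs1
  have hms : μ ^ 3 / s ≤ r ^ 2 / l ^ 2 := by
    rw [div_le_iff₀ (by positivity)] at hsy
    rw [div_le_div_iff₀ hs0 (by positivity)]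
    linarith
  have hfib : ∑ q ∈ A.image par, ((A.filter (fun a => par a = q)).card : ℝ) = μ ^ 3 := by
    rw [← hA, ← Nat.cast_sum, ← Finset.card_eq_sum_card_image]
  have hIq : ∀ q ∈ A.image par, ((I q).card : ℝ) ≤ C * (ν ^ 3 / r) * l := by
    intro q hq
    refine (h6 q hq).trans ?_
    rw [hB]
    gcongr
  have key : ∀ (g : V → ℝ) (G S : ℝ), (∀ q, 0 ≤ g q) → (∀ q ∈ A.image par, g q ≤ G) → 0 ≤ G →
      ∑ q ∈ A.image par, g q ≤ S →
      ∑ i ∈ A.image par', g (par i) ≤ G * (r ^ 2 / l ^ 2) + S := by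
    intro g G S hg hG hG0 hS
    refine (k3 g hg).trans ?_
    have : ∑ q ∈ A.image par, g q * (((A.filter (fun a => par a = q)).card : ℝ) / s + 1) ≤
        ∑ q ∈ A.image par, (G * (((A.filter (fun a => par a = q)).card : ℝ) / s) + g q) := by
      refine Finset.sum_le_sum fun q hq => ?_
      rw [mul_add, mul_one]
      gcongr
      exact hG q hq
    refine this.trans ?_
    rw [Finset.sum_add_distrib, ← Finset.mul_sum, ← Finset.sum_div, hfib]
    gcongr
  have hCC : C ≤ C ^ 2 := le_self_pow₀ hC (by norm_num)
  have hnr : ν ^ 3 * r ≤ ν ^ 3 + μ ^ 2 * ν ^ 2 / l ^ 3 := by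
    calc ν ^ 3 * r ≤ ν ^ 3 * (1 + x) := by gcongr
      _ = _ := by rw [hx]; field_simp
  refine ⟨par', fun q => I (par q), r, fun a ha => (k1 a ha).1, fun q => h2 _, hr1, hrx, ?_, ?_,
    ?_, ?_⟩
  · intro q
    have : ((A.filter (fun a => par' a = q)).card : ℝ) ≤ s := by exact_mod_cast k2 q
    calc ((A.filter (fun a => par' a = q)).card : ℝ) * r ^ 2
        ≤ (2 * (μ ^ 3 * l ^ 2 / r ^ 2)) * r ^ 2 := by gcongr; exact this.trans hs2
      _ = _ := by field_simp
  · rw [hB] at h4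
    refine (key (fun q => ((I q).card : ℝ) ^ 2) ((C * (ν ^ 3 / r) * l) ^ 2) _
      (fun q => by positivity) (fun q hq => ?_) (by positivity) h4).trans ?_
    · have := hIq q hq
      gcongr
    · have : (C * (ν ^ 3 / r) * l) ^ 2 * (r ^ 2 / l ^ 2) = C ^ 2 * (ν ^ 3) ^ 2 := by field_simp
      rw [this]
      nlinarith [mul_le_mul_of_nonneg_right hCC (sq_nonneg (ν ^ 3))]
  · rw [hB] at h5
    refine (key (fun q => ((I q).card : ℝ)) (C * (ν ^ 3 / r) * l) _
      (fun q => by positivity) hIq (by positivity) h5).trans ?_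
    have e : C * (ν ^ 3 / r) * l * (r ^ 2 / l ^ 2) = C * (ν ^ 3 * r) / l := by field_simp
    have e2 : C * (ν ^ 3 * r) / l ≤ C * (ν ^ 3 * r) := div_le_self (by positivity) hl1
    rw [e]
    have e3 : C * (ν ^ 3 * r) ≤ C ^ 2 * (ν ^ 3 + μ ^ 2 * ν ^ 2 / l ^ 3) := by gcongr
    linarith
  · refine (h7.congr ?_).mono ?_ ?_
    · intro a b
      refine and_congr_right fun ha => ?_
      beta_reduce
      rw [(k1 a ha).2]
    · calc 2 * C * r ^ 2 ≤ 2 * C * (μ ^ 2 * 1) := by rw [mul_one]; gcongr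
        _ ≤ _ := by gcongr; exact one_le_pow₀ hν
    · rw [hA, hB]
      have e1 : r * (1 + Real.log r) ^ 3 ≤ 1 + x * l ^ 3 :=
        mul_one_add_log_pow_le hr1 le_rfl hx0 hlr
      have e2 : ν ^ 3 * (r * (1 + Real.log r) ^ 3) ≤ ν ^ 3 * (1 + x * l ^ 3) := by gcongr
      have e3 : ν ^ 3 * (1 + x * l ^ 3) = ν ^ 3 + μ ^ 2 * ν ^ 2 := by rw [hx]; field_simp
      have e4 : μ ^ 3 * (1 + Real.log r) ≤ μ ^ 3 * l := by gcongr
      refine mul_le_mul_of_nonneg_left ?_ (by positivity)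
      linarith

theorem sum_mul_rpow_two_thirds_le {ι : Type*} (s : Finset ι) (f g : ι → ℝ)
    (hf : ∀ i ∈ s, 0 ≤ f i) (hg : ∀ i ∈ s, 0 ≤ g i) :
    ∑ i ∈ s, (f i * g i) ^ ((2 : ℝ) / 3) ≤
      (∑ i ∈ s, f i ^ 2) ^ ((1 : ℝ) / 3) * (∑ i ∈ s, g i) ^ ((2 : ℝ) / 3) := by
  have hpq : Real.HolderConjugate 3 (3 / 2) := by
    rw [Real.holderConjugate_iff]; norm_num
  have := Real.inner_le_Lp_mul_Lq_of_nonneg s hpq (f := fun i => f i ^ ((2 : ℝ) / 3))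
    (g := fun i => g i ^ ((2 : ℝ) / 3)) (fun i hi => Real.rpow_nonneg (hf i hi) _)
    (fun i hi => Real.rpow_nonneg (hg i hi) _)
  have e1 : ∑ i ∈ s, (f i ^ ((2 : ℝ) / 3)) ^ (3 : ℝ) = ∑ i ∈ s, f i ^ 2 :=
    Finset.sum_congr rfl fun i hi => by
      rw [← Real.rpow_mul (hf i hi), ← Real.rpow_natCast]; norm_num
  have e2 : ∑ i ∈ s, (g i ^ ((2 : ℝ) / 3)) ^ ((3 : ℝ) / 2) = ∑ i ∈ s, g i :=
    Finset.sum_congr rfl fun i hi => by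
      rw [← Real.rpow_mul (hg i hi)]; norm_num
  rw [e1, e2] at this
  refine le_trans (le_of_eq ?_) (this.trans (le_of_eq ?_))
  · exact Finset.sum_congr rfl fun i hi => Real.mul_rpow (hf i hi) (hg i hi)
  · norm_num

def HasCovers {V : Type*} (rel : V → V → Prop) (t κ D : ℝ) : Prop :=
  ∀ A B : Finset V, A.card ≤ B.card → (A.card : ℝ) ≤ t →
    BicliqueCover (fun a b => a ∈ A ∧ b ∈ B ∧ rel a b)
      (κ * ((A.card : ℝ) * B.card) ^ ((2 : ℝ) / 3))
      (κ * ((A.card : ℝ) * B.card) ^ ((2 : ℝ) / 3) +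
        D * (((A.card : ℝ) + B.card) * (1 + Real.log A.card)))

theorem Real.log_natCast_le_log {k : ℕ} {t : ℝ} (ht : 1 ≤ t) (hk : (k : ℝ) ≤ t) :
    Real.log k ≤ Real.log t := by
  rcases Nat.eq_zero_or_pos k with rfl | h
  · simpa using Real.log_nonneg ht
  · exact Real.log_le_log (by exact_mod_cast h) hk

theorem HasCovers.cover {V : Type*} {rel : V → V → Prop} {t κ D : ℝ} (h : HasCovers rel t κ D)
    (hrel : ∀ a b, rel a b → rel b a) (ht : 1 ≤ t) (hD : 0 ≤ D) (U W : Finset V)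
    (hU : (U.card : ℝ) ≤ t) :
    BicliqueCover (fun a b => a ∈ U ∧ b ∈ W ∧ rel a b)
      (κ * ((U.card : ℝ) * W.card) ^ ((2 : ℝ) / 3))
      (κ * ((U.card : ℝ) * W.card) ^ ((2 : ℝ) / 3) +
        D * (((U.card : ℝ) + W.card) * (1 + Real.log t))) := by
  rcases le_total U.card W.card with hUW | hUW
  · refine (h U W hUW hU).mono le_rfl ?_
    have := Real.log_natCast_le_log ht hU
    gcongr
  · have hW : (W.card : ℝ) ≤ t := le_trans (by exact_mod_cast hUW) hU
    refine ((h W U hUW hW).swap.congr ?_).mono ?_ ?_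
    · exact fun a b => ⟨fun h => ⟨h.2.1, h.1, hrel _ _ h.2.2⟩,
        fun h => ⟨h.2.1, h.1, hrel _ _ h.2.2⟩⟩
    · rw [mul_comm (U.card : ℝ)]
    · rw [mul_comm (U.card : ℝ), add_comm (U.card : ℝ)]
      have := Real.log_natCast_le_log ht hW
      gcongr

theorem HasCovers.cover_piece {V : Type*} [DecidableEq V] {rel : V → V → Prop}
    {C t κ D x l : ℝ} (h : HasCuttings rel C) (hC : 1 ≤ C) (hc : HasCovers rel t κ D)
    (hrel : ∀ a b, rel a b → rel b a) (ht : 1 ≤ t) (hκ : 0 ≤ κ) (hD : 0 ≤ D) (R Q : Finset V)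
    (hR : R.Nonempty) (hx : 0 ≤ x) (hl : 1 + Real.log R.card ≤ l)
    (hRt : C * (R.card / min (max 1 x) R.card) * l ≤ t) :
    BicliqueCover (fun a b => a ∈ R ∧ b ∈ Q ∧ rel a b)
      (2 * C * (R.card * (1 + x)) +
        κ * (C * ((Q.card : ℝ) * R.card) ^ ((2 : ℝ) / 3)))
      (156 * C ^ 2 * (Q.card * l + R.card * (1 + x * l ^ 3)) +
        κ * (C * ((Q.card : ℝ) * R.card) ^ ((2 : ℝ) / 3)) +
        D * ((C * (R.card * (1 + x)) + Q.card) * (1 + Real.log t))) := by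
  classical
  have hk : (1 : ℝ) ≤ R.card := by exact_mod_cast hR.card_pos
  obtain ⟨r, hr⟩ : ∃ r, r = min (max 1 x) (R.card : ℝ) := ⟨_, rfl⟩
  rw [← hr] at hRt
  have hr1 : 1 ≤ r := hr ▸ le_min (le_max_left _ _) hk
  have hrk : r ≤ (R.card : ℝ)  := hr ▸ min_le_right _ _
  have hrx : r ≤ max 1 x  := hr ▸ min_le_left _ _
  clear hr
  have hrx1 : r ≤ 1 + x := hrx.trans (max_le (by linarith) (by linarith))
  have hlog := Real.log_nonneg hr1
  have hlr : 1 + Real.log r ≤ l :=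
    le_trans (by linarith [Real.log_le_log (by linarith) hrk]) hl
  have hlogt : 0 ≤ Real.log t := Real.log_nonneg ht
  obtain ⟨par, J, h1, h2, -, h4, h5, h6, h7⟩ := h.exists_partition hC Q R r hr1 hrk
  have hJt : ∀ q ∈ Q.image par, ((J q).card : ℝ) ≤ t := by
    intro q hq
    refine (h6 q hq).trans (le_trans ?_ hRt)
    gcongr
  have H := BicliqueCover.biUnion (Q.image par)
    (fun q a b => a ∈ J q ∧ b ∈ Q.filter (fun b => par b = q) ∧ rel a b) _ _
    (fun q hq => hc.cover hrel ht hD (J q) (Q.filter (fun b => par b = q)) (hJt q hq)) ?_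
  · have hfib : ∑ q ∈ Q.image par, ((Q.filter (fun a => par a = q)).card : ℝ) = Q.card := by
      rw [← Nat.cast_sum, ← Finset.card_eq_sum_card_image]
    have hY : ∑ q ∈ Q.image par, κ * (((J q).card : ℝ) *
        (Q.filter (fun b => par b = q)).card) ^ ((2 : ℝ) / 3) ≤
        κ * (C * ((Q.card : ℝ) * (R.card : ℝ)) ^ ((2 : ℝ) / 3)) := by
      rw [← Finset.mul_sum]
      refine mul_le_mul_of_nonneg_left ?_ hκ
      refine (sum_mul_rpow_two_thirds_le _ _ _ (fun _ _ => by positivity)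
        (fun _ _ => by positivity)).trans ?_
      rw [hfib]
      have e1 : (∑ q ∈ Q.image par, ((J q).card : ℝ) ^ 2) ^ ((1 : ℝ) / 3) ≤
          (C ^ 3 * (R.card : ℝ) ^ 2) ^ ((1 : ℝ) / 3) := by
        gcongr
        refine h4.trans ?_
        gcongr
        exact le_self_pow₀ hC (by norm_num)
      have e2 : (C ^ 3 * (R.card : ℝ) ^ 2) ^ ((1 : ℝ) / 3) = C * (R.card : ℝ) ^ ((2 : ℝ) / 3) := by
        rw [Real.mul_rpow (by positivity) (by positivity), ← Real.rpow_natCast,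
          ← Real.rpow_natCast, ← Real.rpow_mul (by linarith), ← Real.rpow_mul (by linarith)]
        norm_num
      rw [e2] at e1
      rw [Real.mul_rpow (by positivity) (by positivity)]
      calc _ ≤ C * (R.card : ℝ) ^ ((2 : ℝ) / 3) * (Q.card : ℝ) ^ ((2 : ℝ) / 3) :=
              mul_le_mul_of_nonneg_right e1 (by positivity)
        _ = _ := by ring
    refine ((h7.swap.add H ?_).congr ?_).mono ?_ ?_
    · rintro a b ⟨_, _, hJ, _⟩ ⟨q, _, ha, hb, _⟩
      rw [(Finset.mem_filter.1 hb).2] at hJ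
      exact hJ ha
    · intro a b
      constructor
      · rintro ⟨ha, hb, hab⟩
        by_cases hJ : a ∈ J (par b)
        · exact Or.inr ⟨par b, Finset.mem_image_of_mem _ hb, hJ, by simp [hb], hab⟩
        · exact Or.inl ⟨hb, ha, hJ, hrel _ _ hab⟩
      · rintro (⟨hb, ha, _, hab⟩ | ⟨q, _, ha, hb, hab⟩)
        · exact ⟨ha, hb, hrel _ _ hab⟩
        · exact ⟨h2 _ ha, (Finset.mem_filter.1 hb).1, hab⟩
    · refine add_le_add ?_ hY
      calc 2 * C * r ^ 2 = 2 * C * (r * r) := by ring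
        _ ≤ 2 * C * ((R.card : ℝ) * (1 + x)) := by gcongr
    · have e6 : ∑ q ∈ Q.image par, D * ((((J q).card : ℝ) +
          (Q.filter (fun b => par b = q)).card) * (1 + Real.log t)) =
          D * ((∑ q ∈ Q.image par, ((J q).card : ℝ) + Q.card) * (1 + Real.log t)) := by
        rw [← Finset.mul_sum, ← Finset.sum_mul, Finset.sum_add_distrib, hfib]
      rw [Finset.sum_add_distrib, e6, ← add_assoc]
      have e3 := mul_one_add_log_pow_le hr1 hrx hx hlr
      refine add_le_add (add_le_add ?_ hY) ?_
      · refine mul_le_mul_of_nonneg_left ?_ (by positivity)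
        have e4 : (R.card : ℝ) * (r * (1 + Real.log r) ^ 3) ≤ (R.card : ℝ) * (1 + x * l ^ 3) := by gcongr
        have e5 : (Q.card : ℝ) * (1 + Real.log r) ≤ Q.card * l := by gcongr
        linarith
      · gcongr
        refine h5.trans ?_
        rw [← mul_assoc]
        gcongr
  · rintro i _ j _ a b ⟨_, hb, _⟩ ⟨_, hb', _⟩
    exact (Finset.mem_filter.1 hb).2.symm.trans (Finset.mem_filter.1 hb').2

theorem recursion_size_le {C D l m n Z w S L κ : ℝ} (hC : 1 ≤ C) (hl : 1 ≤ l) (hm : 0 ≤ m)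
    (hn : 0 ≤ n) (hw : 0 ≤ w) (hwZ : w * l ^ 3 = Z) (hS : S ≤ 2 * C ^ 2 * (n + w))
    (hL0 : 0 ≤ L) (hL : 6 * C ^ 2 * L ≤ l) (hκ : 1 ≤ κ) (hD : 1248 * C ^ 4 ≤ D) :
    156 * C ^ 2 * (m * l + n + Z) + (156 * C ^ 2 * (S * l + (m + Z)) + κ * (C * (2 * C * Z)) +
      D * ((C * (m + w) + S) * L)) ≤ (800 * C ^ 4 + D) * κ * Z + D * ((m + n) * l) := by
  have hZ0 : 0 ≤ Z := by rw [← hwZ]; positivity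
  have hwl : w * l ≤ Z := by
    rw [← hwZ]
    have : l ≤ l ^ 3 := le_self_pow₀ hl (by norm_num)
    gcongr
  have hCC : C ≤ C ^ 2 := le_self_pow₀ hC (by norm_num)
  have h24 : C ^ 2 ≤ C ^ 4 := pow_le_pow_right₀ hC (by norm_num)
  have hD0 : 0 ≤ D := le_trans (by positivity) hD
  have f1 : S * l ≤ 2 * C ^ 2 * (n * l + Z) := by
    calc S * l ≤ 2 * C ^ 2 * (n + w) * l := by gcongr
      _ = 2 * C ^ 2 * (n * l + w * l) := by ring
      _ ≤ _ := by gcongr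
  have f2 : C * (m + w) + S ≤ 3 * C ^ 2 * (m + n + w) := by
    have : C * (m + w) ≤ C ^ 2 * (m + w) := by gcongr
    have : 0 ≤ C ^ 2 * n := by positivity
    have : 0 ≤ C ^ 2 * m := by positivity
    linarith
  have f3 : (C * (m + w) + S) * L ≤ ((m + n) * l + Z) / 2 := by
    calc (C * (m + w) + S) * L ≤ 3 * C ^ 2 * (m + n + w) * L := by gcongr
      _ = (m + n + w) * (6 * C ^ 2 * L) / 2 := by ring
      _ ≤ (m + n + w) * l / 2 := by gcongr
      _ ≤ _ := by linarith
  have f4 : D * ((C * (m + w) + S) * L) ≤ D * (((m + n) * l + Z) / 2) := by gcongr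
  have f5 : C ^ 2 * (S * l) ≤ C ^ 2 * (2 * C ^ 2 * (n * l + Z)) := by gcongr
  have f6 : C ^ 2 * (m * l + n + m) ≤ C ^ 4 * (2 * (m + n) * l) := by
    gcongr
    nlinarith
  have f7 : C ^ 2 * Z ≤ C ^ 4 * Z := by gcongr
  have f8 : 1248 * C ^ 4 * ((m + n) * l) ≤ D * ((m + n) * l) := by gcongr
  have f9 : C ^ 4 * Z * 1 ≤ C ^ 4 * Z * κ := by gcongr
  have f10 : D * Z * 1 ≤ D * Z * κ := by gcongr
  have f11 : C ^ 2 * (κ * Z) ≤ C ^ 4 * (κ * Z) := by gcongr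
  have f12 : 0 ≤ C ^ 4 * (m * l) := by positivity
  have f13 : 0 ≤ D * Z * κ := by positivity
  have f14 : 0 ≤ C ^ 4 * (Z * κ) := by positivity
  linear_combination f4 + 156 * f5 + 156 * f6 + 312 * f7 + f8 / 2 + 624 * f9 + f10 / 2 + 2 * f11 +
    312 * f12 + f13 / 2 + 174 * f14

theorem BicliqueCover.stars {V : Type*} (rel : V → V → Prop) (A B : Finset V) :
    BicliqueCover (fun a b => a ∈ A ∧ b ∈ B ∧ rel a b) A.card
      ((A.card : ℝ) + A.card * B.card) := by
  classical
  refine ((BicliqueCover.rectangles A (fun a => {a}) (fun a => B.filter (rel a)) ?_).congr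
    ?_).mono le_rfl ?_
  · intro p _ q _ hpq
    simpa using hpq
  · intro a b
    simp
  · rw [Finset.sum_add_distrib]
    simp only [Finset.card_singleton, Nat.cast_one, Finset.sum_const, nsmul_eq_mul, mul_one]
    gcongr
    rw [← nsmul_eq_mul, ← Finset.sum_const]
    exact Finset.sum_le_sum fun a _ => by exact_mod_cast Finset.card_filter_le _ _

theorem HasCovers.mono {V : Type*} {rel : V → V → Prop} {t t' κ κ' D : ℝ}
    (h : HasCovers rel t κ D) (ht : t' ≤ t) (hκ : κ ≤ κ') : HasCovers rel t' κ' D := by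
  intro A B hAB hA
  refine (h A B hAB (hA.trans ht)).mono ?_ ?_ <;> gcongr

theorem cbrt_facts (k : ℕ) : ((k : ℝ) ^ ((1 : ℝ) / 3)) ^ 3 = k ∧
    ((k : ℝ) ^ ((1 : ℝ) / 3)) ^ 2 = (k : ℝ) ^ ((2 : ℝ) / 3) := by
  have hk : (0 : ℝ) ≤ k := by positivity
  constructor <;> rw [← Real.rpow_natCast, ← Real.rpow_mul hk] <;> norm_num

theorem HasCovers.of_card_le {V : Type*} (rel : V → V → Prop) {t κ D : ℝ}
    (hκ : 1 ≤ κ) (hD : 1 ≤ D) (ht : t ≤ D) : HasCovers rel t κ D := by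
  intro A B hAB hA
  obtain ⟨hm, hm2⟩ := cbrt_facts A.card
  obtain ⟨hn, hn2⟩ := cbrt_facts B.card
  have hle : (A.card : ℝ) ≤ B.card := by exact_mod_cast hAB
  have h1 : (A.card : ℝ) ≤ ((A.card : ℝ) * B.card) ^ ((2 : ℝ) / 3) := by
    rcases Nat.eq_zero_or_pos A.card with h0 | h0
    · rw [h0]; simp
    · have h1 : (1 : ℝ) ≤ B.card := by exact_mod_cast h0.trans_le hAB
      rw [Real.mul_rpow (by positivity) (by positivity), ← hm2, ← hn2]
      set μ := (A.card : ℝ) ^ ((1 : ℝ) / 3)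
      set ν := (B.card : ℝ) ^ ((1 : ℝ) / 3)
      have hμν : μ ≤ ν := Real.rpow_le_rpow (by positivity) hle (by norm_num)
      have hν : 1 ≤ ν := Real.one_le_rpow h1 (by norm_num)
      have hμ : 0 ≤ μ := by positivity
      rw [← hm]
      calc μ ^ 3 = μ ^ 2 * μ := by ring
        _ ≤ μ ^ 2 * ν ^ 2 := by
          gcongr
          exact hμν.trans (le_self_pow₀ hν (by norm_num))
  have h2 : ((A.card : ℝ) * B.card) ^ ((2 : ℝ) / 3) ≤
      κ * ((A.card : ℝ) * B.card) ^ ((2 : ℝ) / 3) :=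
    le_mul_of_one_le_left (by positivity) hκ
  refine (BicliqueCover.stars rel A B).mono (h1.trans h2) ?_
  have h3 : 0 ≤ Real.log A.card := Real.log_natCast_nonneg _
  have h4 : ((A.card : ℝ) + B.card) * 1 ≤ ((A.card : ℝ) + B.card) * (1 + Real.log A.card) := by
    gcongr; linarith
  have h5 : D * (((A.card : ℝ) + B.card) * 1) ≤
      D * (((A.card : ℝ) + B.card) * (1 + Real.log A.card)) := by gcongr
  have h6 : (A.card : ℝ) * B.card ≤ D * B.card := by gcongr; exact hA.trans ht
  have h7 : 0 ≤ (D - 1) * (A.card : ℝ) := mul_nonneg (by linarith) (by positivity)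
  have h8 : (0 : ℝ) ≤ A.card := by positivity
  linarith

theorem sum_mul_rpow_two_thirds_le_of_cubes {ι : Type*} (s : Finset ι) (f g : ι → ℝ)
    {C μ ν : ℝ} (hC : 1 ≤ C) (hμ0 : 0 ≤ μ) (hf : ∀ i, 0 ≤ f i)
    (hg : ∀ i, 0 ≤ g i) (hsq : ∑ i ∈ s, f i ^ 2 ≤ 2 * C ^ 2 * (ν ^ 3) ^ 2)
    (hsum : ∑ i ∈ s, g i = μ ^ 3) :
    ∑ i ∈ s, (f i * g i) ^ ((2 : ℝ) / 3) ≤ 2 * C * (μ ^ 2 * ν ^ 2) := by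
  refine (sum_mul_rpow_two_thirds_le _ _ _ (fun i _ => hf i) (fun i _ => hg i)).trans ?_
  rw [hsum]
  have e1 : (∑ i ∈ s, f i ^ 2) ^ ((1 : ℝ) / 3) ≤
      ((2 * C * ν ^ 2) ^ 3) ^ ((1 : ℝ) / 3) := by
    gcongr
    refine hsq.trans ?_
    have : C ^ 2 ≤ C ^ 3 := pow_le_pow_right₀ hC (by norm_num)
    calc 2 * C ^ 2 * (ν ^ 3) ^ 2 ≤ 8 * C ^ 3 * (ν ^ 3) ^ 2 := by gcongr; norm_num
      _ = _ := by ring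
  have e2 : ((2 * C * ν ^ 2) ^ 3) ^ ((1 : ℝ) / 3) = 2 * C * ν ^ 2 := by
    rw [← Real.rpow_natCast, ← Real.rpow_mul (by positivity)]
    norm_num
  have e3 : (μ ^ 3) ^ ((2 : ℝ) / 3) = μ ^ 2 := by
    rw [← Real.rpow_natCast, ← Real.rpow_natCast, ← Real.rpow_mul hμ0]
    norm_num
  rw [e2] at e1
  rw [e3]
  calc _ ≤ 2 * C * ν ^ 2 * μ ^ 2 := mul_le_mul_of_nonneg_right e1 (by positivity)
    _ = _ := by ring

theorem HasCovers.step {V : Type*} [DecidableEq V] {rel : V → V → Prop} {C M D t t' κ : ℝ}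
    (h : HasCuttings rel C) (hC : 1 ≤ C) (hrel : ∀ a b, rel a b → rel b a) (hM : 1 ≤ M)
    (hMlog : ∀ x, M ≤ x → 6 * C ^ 2 * (1 + Real.log (2 * C * (1 + Real.log x) ^ 12)) ≤
      1 + Real.log x)
    (hDM : M ≤ D) (hDC : 1248 * C ^ 4 ≤ D) (hκ : 1 ≤ κ) (hc : HasCovers rel t κ D)
    (ht' : 1 ≤ t') (ht : 2 * C * (1 + Real.log t') ^ 12 ≤ t) :
    HasCovers rel t' ((800 * C ^ 4 + D) * κ) D := by
  have hC4 : 1 ≤ C ^ 4 := one_le_pow₀ hC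
  have hD0 : 0 ≤ D := by linarith
  have hκ0 : 0 ≤ κ := by linarith
  intro A B hAB hA
  rcases le_or_gt (A.card : ℝ) M with hAM | hAM
  · refine HasCovers.of_card_le rel (t := M) ?_ (hM.trans hDM) hDM A B hAB hAM
    nlinarith
  have hm1 : (1 : ℝ) ≤ A.card := hM.trans hAM.le
  have hn1 : (1 : ℝ) ≤ B.card := hm1.trans (by exact_mod_cast hAB)
  obtain ⟨hm, hm2⟩ := cbrt_facts A.card
  obtain ⟨hn, hn2⟩ := cbrt_facts B.card
  have hμ1 : 1 ≤ (A.card : ℝ) ^ ((1 : ℝ) / 3) := Real.one_le_rpow hm1 (by norm_num)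
  have hμν : (A.card : ℝ) ^ ((1 : ℝ) / 3) ≤ (B.card : ℝ) ^ ((1 : ℝ) / 3) :=
    Real.rpow_le_rpow (by positivity) (by exact_mod_cast hAB) (by norm_num)
  rw [Real.mul_rpow (by positivity) (by positivity), ← hm2, ← hn2]
  generalize (A.card : ℝ) ^ ((1 : ℝ) / 3) = μ at *
  generalize (B.card : ℝ) ^ ((1 : ℝ) / 3) = ν at *
  obtain ⟨l, hl⟩ : ∃ l, l = 1 + Real.log A.card := ⟨_, rfl⟩
  have hl1 : 1 ≤ l := by rw [hl]; linarith [Real.log_nonneg hm1]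
  have hl0 : 0 < l := by linarith
  have hν1 : 1 ≤ ν := hμ1.trans hμν
  have hμ0 : 0 < μ := by linarith
  have hν0 : 0 < ν := by linarith
  obtain ⟨par, I, r, h1, h2, h3, h4, h5, h6, h7, h8⟩ :=
    h.exists_coarse_partition hC A B hm.symm hn.symm hμ1 hμν hl
  obtain ⟨T, hT⟩ : ∃ T, T = 2 * C * l ^ 12 := ⟨_, rfl⟩
  have hT1 : 1 ≤ T := by
    have : 1 ≤ l ^ 12 := one_le_pow₀ hl1
    rw [hT]; nlinarith
  have hTt : T ≤ t := by
    refine le_trans ?_ ht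
    rw [hT, hl]
    have := Real.log_natCast_le_log ht' hA
    have := Real.log_nonneg hm1
    gcongr
  have hL : 6 * C ^ 2 * (1 + Real.log T) ≤ l := by
    rw [hT, hl]
    exact hMlog _ hAM.le
  have hlogT := Real.log_nonneg hT1
  have hcT := hc.mono hTt le_rfl
  obtain ⟨x, hx⟩ : ∃ x, x = ν ^ 2 / (μ * l ^ 3) := ⟨_, rfl⟩
  have hx0 : 0 ≤ x := by rw [hx]; positivity
  have hpiece := BicliqueCover.biUnion (A.image par)
    (fun i a b => a ∈ A.filter (fun a => par a = i) ∧ b ∈ I i ∧ rel a b) _ _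
    (fun i hi => hcT.cover_piece h hC hrel hT1 hκ0 hD0 (A.filter (fun a => par a = i)) (I i)
      (x := x) (l := l) ?_ hx0 ?_ ?_) ?_
  · have hfib : ∑ q ∈ A.image par, ((A.filter (fun a => par a = q)).card : ℝ) = μ ^ 3 := by
      rw [← Nat.cast_sum, ← Finset.card_eq_sum_card_image, hm]
    have hY : ∑ i ∈ A.image par, (((I i).card : ℝ) *
        (A.filter (fun a => par a = i)).card) ^ ((2 : ℝ) / 3) ≤ 2 * C * (μ ^ 2 * ν ^ 2) :=
      sum_mul_rpow_two_thirds_le_of_cubes _ _ _ hC hμ0.le (fun _ => Nat.cast_nonneg _)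
        (fun _ => Nat.cast_nonneg _) h6 hfib
    have hmx : μ ^ 3 * x = μ ^ 2 * ν ^ 2 / l ^ 3 := by rw [hx]; field_simp
    have hw : 0 ≤ μ ^ 2 * ν ^ 2 / l ^ 3 := by positivity
    have hwZ : μ ^ 2 * ν ^ 2 / l ^ 3 * l ^ 3 = μ ^ 2 * ν ^ 2 := by field_simp
    refine ((h8.add hpiece ?_).congr ?_).mono ?_ ?_
    · rintro a b ⟨_, _, hI, _⟩ ⟨i, _, ha, hb, _⟩
      rw [(Finset.mem_filter.1 ha).2] at hI
      exact hI hb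
    · intro a b
      constructor
      · rintro ⟨ha, hb, hab⟩
        by_cases hI : b ∈ I (par a)
        · exact Or.inr ⟨par a, Finset.mem_image_of_mem _ ha, by simp [ha], hI, hab⟩
        · exact Or.inl ⟨ha, hb, hI, hab⟩
      · rintro (⟨ha, hb, _, hab⟩ | ⟨i, _, ha, hb, hab⟩)
        · exact ⟨ha, hb, hab⟩
        · exact ⟨(Finset.mem_filter.1 ha).1, h2 _ hb, hab⟩
    · rw [Finset.sum_add_distrib, ← Finset.mul_sum, ← Finset.mul_sum, ← Finset.mul_sum,
        ← Finset.sum_mul, hfib]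
      have e1 : μ ^ 3 ≤ μ ^ 2 * ν ^ 2 := by
        calc μ ^ 3 = μ ^ 2 * μ := by ring
          _ ≤ μ ^ 2 * ν ^ 2 := by
            gcongr
            exact hμν.trans (le_self_pow₀ hν1 (by norm_num))
      have e2 : μ ^ 3 * x ≤ μ ^ 2 * ν ^ 2 := by
        rw [hmx]
        exact div_le_self (by positivity) (one_le_pow₀ hl1)
      have e3 := mul_le_mul_of_nonneg_left hY (by positivity : 0 ≤ κ * C)
      have e4 : C * (μ ^ 3 * (1 + x)) ≤ C * (2 * (μ ^ 2 * ν ^ 2)) :=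
        mul_le_mul_of_nonneg_left (by linarith) (by linarith)
      have e5 : C * (μ ^ 2 * ν ^ 2) ≤ C ^ 4 * (μ ^ 2 * ν ^ 2) := by
        gcongr; exact le_self_pow₀ hC (by norm_num)
      have e6 : C ^ 4 * (μ ^ 2 * ν ^ 2) * 1 ≤ C ^ 4 * (μ ^ 2 * ν ^ 2) * κ := by gcongr
      have e7 : C ^ 2 * (μ ^ 2 * ν ^ 2 * κ) ≤ C ^ 4 * (μ ^ 2 * ν ^ 2 * κ) := by
        gcongr
        norm_num
      have e8 : 0 ≤ D * (μ ^ 2 * ν ^ 2 * κ) := by positivity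
      have e9 : 0 ≤ C ^ 4 * (μ ^ 2 * ν ^ 2 * κ) := by positivity
      linear_combination e3 + 2 * e4 + 6 * e5 + 6 * e6 + 2 * e7 + e8 + 792 * e9
    · have e1 := recursion_size_le hC hl1 (by positivity : 0 ≤ μ ^ 3) (by positivity : 0 ≤ ν ^ 3)
        hw hwZ h7 (by linarith : 0 ≤ 1 + Real.log T) hL hκ hDC
      rw [← hl, ← hm, ← hn]
      refine le_trans (add_le_add le_rfl ?_) e1
      rw [Finset.sum_add_distrib, Finset.sum_add_distrib, ← Finset.mul_sum, ← Finset.mul_sum,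
        ← Finset.mul_sum, ← Finset.mul_sum, ← Finset.sum_mul, Finset.sum_add_distrib,
        Finset.sum_add_distrib, ← Finset.sum_mul, ← Finset.sum_mul, ← Finset.mul_sum,
        ← Finset.sum_mul, hfib]
      have e2 : μ ^ 3 * (1 + x * l ^ 3) = μ ^ 3 + μ ^ 2 * ν ^ 2 := by
        rw [← hwZ, ← hmx]; ring
      have e3 : μ ^ 3 * (1 + x) = μ ^ 3 + μ ^ 2 * ν ^ 2 / l ^ 3 := by
        rw [← hmx]; ring
      rw [e2, e3]
      have e4 := mul_le_mul_of_nonneg_left hY (by positivity : 0 ≤ κ * C)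
      linear_combination e4
  · obtain ⟨a, ha, rfl⟩ := Finset.mem_image.1 hi
    exact ⟨a, by simp [ha]⟩
  · rw [hl]
    have := Real.log_natCast_le_log hm1 (k := (A.filter (fun a => par a = i)).card)
      (by exact_mod_cast Finset.card_filter_le _ _)
    linarith
  · have hk : (1 : ℝ) ≤ (A.filter (fun a => par a = i)).card := by
      obtain ⟨a, ha, rfl⟩ := Finset.mem_image.1 hi
      exact_mod_cast Finset.card_pos.2 ⟨a, by simp [ha]⟩
    have h5i := h5 i
    generalize ((A.filter (fun a => par a = i)).card : ℝ) = k at *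
    have hl11 : 1 ≤ l ^ 11 := one_le_pow₀ hl1
    have hkx : k ≤ 2 * l ^ 11 * x := by
      have e1 : (μ ^ 2 / (ν * l ^ 3)) ^ 2 * x * l ^ 9 = μ ^ 3 := by rw [hx]; field_simp
      have e2 : k * (μ ^ 2 / (ν * l ^ 3)) ^ 2 ≤
          (2 * l ^ 11 * x) * (μ ^ 2 / (ν * l ^ 3)) ^ 2 := by
        calc k * (μ ^ 2 / (ν * l ^ 3)) ^ 2 ≤ k * r ^ 2 := by gcongr
          _ ≤ 2 * μ ^ 3 * l ^ 2 := h5i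
          _ = _ := by rw [← e1]; ring
      exact le_of_mul_le_mul_right e2 (by positivity)
    have hkk : k ≤ 2 * l ^ 11 * min (max 1 x) k := by
      rcases min_choice (max 1 x) k with h | h <;> rw [h]
      · exact hkx.trans (mul_le_mul_of_nonneg_left (le_max_right _ _) (by positivity))
      · exact le_mul_of_one_le_left (by linarith) (by linarith)
    have hmin : 0 < min (max 1 x) k := lt_min (by positivity) (by linarith)
    rw [hT]
    calc C * (k / min (max 1 x) k) * l ≤ C * (2 * l ^ 11) * l := by
          gcongr
          rwa [div_le_iff₀ hmin]
      _ = _ := by ring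
  · rintro i _ j _ a b ⟨ha, _⟩ ⟨ha', _⟩
    exact (Finset.mem_filter.1 ha).2.symm.trans (Finset.mem_filter.1 ha').2

theorem eventually_const_mul_log_pow_le (c : ℝ) (k : ℕ) :
    ∀ᶠ y : ℝ in Filter.atTop, c * Real.log y ^ k ≤ y - 1 := by
  have h := (Real.isLittleO_pow_log_id_atTop (n := k)).def
    (show (0 : ℝ) < 1 / (2 * (|c| + 1)) by positivity)
  filter_upwards [h, Filter.eventually_ge_atTop 2] with y hy hy2
  rw [Real.norm_eq_abs, Real.norm_eq_abs, id, abs_of_nonneg (by linarith : (0 : ℝ) ≤ y)] at hy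
  have h1 : c * Real.log y ^ k ≤ (|c| + 1) * |Real.log y ^ k| := by
    refine (le_abs_self _).trans ?_
    rw [abs_mul]
    gcongr
    linarith
  have h2 : (|c| + 1) * |Real.log y ^ k| ≤ (|c| + 1) * (1 / (2 * (|c| + 1)) * y) := by gcongr
  have h3 : (|c| + 1) * (1 / (2 * (|c| + 1)) * y) = y / 2 := by field_simp
  linarith

theorem exists_log_threshold {C : ℝ} (hC : 1 ≤ C) : ∃ M : ℝ, 2 ≤ M ∧ ∀ x, M ≤ x →
    6 * C ^ 2 * (1 + Real.log (2 * C * (1 + Real.log x) ^ 12)) ≤ 1 + Real.log x ∧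
    2 * C * (1 + Real.log (2 * C * (1 + Real.log x) ^ 12)) ^ 12 ≤ Real.logb 2 x := by
  have htop : Filter.Tendsto (fun x : ℝ => 1 + Real.log x) Filter.atTop Filter.atTop :=
    Filter.tendsto_atTop_add_const_left _ _ Real.tendsto_log_atTop
  have key : ∀ᶠ y : ℝ in Filter.atTop,
      6 * C ^ 2 * (1 + Real.log (2 * C * y ^ 12)) ≤ y ∧
      2 * C * (1 + Real.log (2 * C * y ^ 12)) ^ 12 ≤ y - 1 := by
    filter_upwards [eventually_const_mul_log_pow_le (6 * C ^ 2 * 13) 1,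
      eventually_const_mul_log_pow_le (2 * C * 13 ^ 12) 12,
      Real.tendsto_log_atTop.eventually_ge_atTop (1 + Real.log (2 * C)),
      Filter.eventually_ge_atTop 1] with y h1 h2 h3 h4
    have e : Real.log (2 * C * y ^ 12) = Real.log (2 * C) + 12 * Real.log y := by
      rw [Real.log_mul (by positivity) (by positivity), Real.log_pow]; norm_num
    have e0 : 0 ≤ Real.log (2 * C) := Real.log_nonneg (by linarith)
    have e1 : 0 ≤ Real.log y := Real.log_nonneg h4
    have e2 : 1 + Real.log (2 * C * y ^ 12) ≤ 13 * Real.log y := by rw [e]; linarith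
    have e3 : 0 ≤ 1 + Real.log (2 * C * y ^ 12) := by rw [e]; linarith
    constructor
    · calc 6 * C ^ 2 * (1 + Real.log (2 * C * y ^ 12)) ≤ 6 * C ^ 2 * (13 * Real.log y) := by
            gcongr
        _ = 6 * C ^ 2 * 13 * Real.log y ^ 1 := by ring
        _ ≤ y := by linarith
    · calc 2 * C * (1 + Real.log (2 * C * y ^ 12)) ^ 12 ≤ 2 * C * (13 * Real.log y) ^ 12 := by
            gcongr
        _ = 2 * C * 13 ^ 12 * Real.log y ^ 12 := by ring
        _ ≤ y - 1 := h2
  obtain ⟨M, hM⟩ := Filter.eventually_atTop.1 (htop.eventually key)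
  refine ⟨max M 2, le_max_right _ _, fun x hx => ?_⟩
  obtain ⟨h1, h2⟩ := hM x ((le_max_left _ _).trans hx)
  refine ⟨h1, h2.trans ?_⟩
  have hx2 : 2 ≤ x := (le_max_right _ _).trans hx
  rw [add_sub_cancel_left, Real.logb, le_div_iff₀ (Real.log_pos (by norm_num))]
  have : 0 ≤ Real.log x := Real.log_nonneg (by linarith)
  nlinarith [Real.log_two_lt_d9]

theorem logStar_spec (x : ℝ) : (Real.logb 2)^[logStar x] x ≤ 2 := by
  have hne : ∀ (k : ℕ) (x : ℝ), x ≤ k + 2 → ∃ j : ℕ, (Real.logb 2)^[j] x ≤ 2 := by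
    intro k
    induction k with
    | zero => exact fun x hx => ⟨0, by simpa using hx⟩
    | succ k ih =>
      intro x hx
      rcases le_or_gt x 2 with h | h
      · exact ⟨0, by simpa using h⟩
      · have h1 : Real.logb 2 x ≤ x - 1 := by
          rw [Real.logb, div_le_iff₀ (Real.log_pos (by norm_num))]
          have h2 := Real.log_le_sub_one_of_pos (show 0 < x / 2 by linarith)
          rw [Real.log_div (by linarith) (by norm_num)] at h2
          nlinarith [Real.log_two_gt_d9]
        push_cast at hx
        obtain ⟨j, hj⟩ := ih (Real.logb 2 x) (by linarith)
        exact ⟨j + 1, by rwa [Function.iterate_succ_apply]⟩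
  have : {k : ℕ | (Real.logb 2)^[k] x ≤ 2}.Nonempty := by
    obtain ⟨k, hk⟩ := exists_nat_ge x
    exact hne k x (by linarith)
  exact Nat.sInf_mem this

theorem HasCovers.iterate {V : Type*} [DecidableEq V] {rel : V → V → Prop} {C M D : ℝ}
    (h : HasCuttings rel C) (hC : 1 ≤ C) (hrel : ∀ a b, rel a b → rel b a) (hM : 2 ≤ M)
    (hMx : ∀ x, M ≤ x →
      6 * C ^ 2 * (1 + Real.log (2 * C * (1 + Real.log x) ^ 12)) ≤ 1 + Real.log x ∧
      2 * C * (1 + Real.log (2 * C * (1 + Real.log x) ^ 12)) ^ 12 ≤ Real.logb 2 x)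
    (hDM : M ≤ D) (hDC : 1248 * C ^ 4 ≤ D) (k : ℕ) : ∀ x : ℝ, (Real.logb 2)^[k] x ≤ 2 →
      HasCovers rel x (((800 * C ^ 4 + D) ^ 2) ^ k) D := by
  have hC4 : 1 ≤ C ^ 4 := one_le_pow₀ hC
  have hK : 1 ≤ (800 * C ^ 4 + D) ^ 2 := one_le_pow₀ (by linarith)
  induction k with
  | zero =>
    intro x hx
    have hx2 : x ≤ 2 := hx
    exact HasCovers.of_card_le rel (by simp) (by linarith) (hx2.trans (hM.trans hDM))
  | succ k ih =>
    intro x hx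
    rcases le_or_gt x M with hxM | hxM
    · exact HasCovers.of_card_le rel (one_le_pow₀ hK) (by linarith) (hxM.trans hDM)
    · rw [Function.iterate_succ_apply] at hx
      have hκ : 1 ≤ ((800 * C ^ 4 + D) ^ 2) ^ k := one_le_pow₀ hK
      have hlog : 0 ≤ Real.log x := Real.log_nonneg (by linarith)
      have hy : 1 ≤ 2 * C * (1 + Real.log x) ^ 12 := by
        have : 1 ≤ (1 + Real.log x) ^ 12 := one_le_pow₀ (by linarith)
        nlinarith
      have s1 := (ih _ hx).step h hC hrel (by linarith) (fun x hx => (hMx x hx).1) hDM hDC hκ hy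
        (hMx x hxM.le).2
      have s2 := s1.step h hC hrel (by linarith) (fun x hx => (hMx x hx).1) hDM hDC
        (by nlinarith) (by linarith) le_rfl
      refine s2.mono le_rfl (le_of_eq ?_)
      ring

theorem HasCuttings.exists_cover_bound {C : ℝ} (hC : 1 ≤ C) : ∃ K : ℝ, 0 < K ∧
    ∀ {V : Type} [DecidableEq V] (rel : V → V → Prop), HasCuttings rel C →
      (∀ a b, rel a b → rel b a) → ∀ A B : Finset V, 2 ≤ A.card → 2 ≤ B.card →
      BicliqueCover (fun a b => a ∈ A ∧ b ∈ B ∧ rel a b)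
        (K ^ logStar ((A.card : ℝ) + B.card) * (A.card : ℝ) ^ ((2 : ℝ) / 3) *
          (B.card : ℝ) ^ ((2 : ℝ) / 3))
        (K ^ logStar ((A.card : ℝ) + B.card) * (A.card : ℝ) ^ ((2 : ℝ) / 3) *
          (B.card : ℝ) ^ ((2 : ℝ) / 3) +
          K * ((A.card : ℝ) * Real.logb 2 B.card + B.card * Real.logb 2 A.card)) := by
  obtain ⟨M, hM, hMx⟩ := exists_log_threshold hC
  obtain ⟨D, hD⟩ : ∃ D, D = max M (1248 * C ^ 4) := ⟨_, rfl⟩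
  have hDM : M ≤ D := hD ▸ le_max_left _ _
  have hDC : 1248 * C ^ 4 ≤ D := hD ▸ le_max_right _ _
  have hD0 : 0 ≤ D := by linarith
  refine ⟨(800 * C ^ 4 + D) ^ 2 + 2 * D, by positivity, ?_⟩
  intro V _ rel h hrel
  obtain ⟨K, hK⟩ : ∃ K, K = (800 * C ^ 4 + D) ^ 2 + 2 * D := ⟨_, rfl⟩
  rw [← hK]
  have main : ∀ A B : Finset V, 2 ≤ A.card → 2 ≤ B.card → A.card ≤ B.card →
      BicliqueCover (fun a b => a ∈ A ∧ b ∈ B ∧ rel a b)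
        (K ^ logStar ((A.card : ℝ) + B.card) * (A.card : ℝ) ^ ((2 : ℝ) / 3) *
          (B.card : ℝ) ^ ((2 : ℝ) / 3))
        (K ^ logStar ((A.card : ℝ) + B.card) * (A.card : ℝ) ^ ((2 : ℝ) / 3) *
          (B.card : ℝ) ^ ((2 : ℝ) / 3) +
          K * ((A.card : ℝ) * Real.logb 2 B.card + B.card * Real.logb 2 A.card)) := by
    intro A B hA hB hAB
    have hA2 : (2 : ℝ) ≤ A.card := by exact_mod_cast hA
    have hAB' : (A.card : ℝ) ≤ B.card := by exact_mod_cast hAB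
    have H := HasCovers.iterate h hC hrel hM hMx hDM hDC _ _
      (logStar_spec ((A.card : ℝ) + B.card)) A B hAB (by linarith)
    have e1 : ((800 * C ^ 4 + D) ^ 2) ^ logStar ((A.card : ℝ) + B.card) *
        ((A.card : ℝ) * B.card) ^ ((2 : ℝ) / 3) ≤ K ^ logStar ((A.card : ℝ) + B.card) *
        (A.card : ℝ) ^ ((2 : ℝ) / 3) * (B.card : ℝ) ^ ((2 : ℝ) / 3) := by
      rw [Real.mul_rpow (by positivity) (by positivity), ← mul_assoc]
      gcongr
      linarith
    refine H.mono e1 (add_le_add e1 ?_)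
    have hlA : 1 ≤ Real.logb 2 A.card := by
      rw [Real.le_logb_iff_rpow_le (by norm_num) (by linarith)]
      simpa using hA2
    have hlAB : Real.logb 2 A.card ≤ Real.logb 2 B.card :=
      Real.logb_le_logb_of_le (by norm_num) (by linarith) hAB'
    have hll : Real.log A.card ≤ Real.logb 2 A.card := by
      rw [Real.logb, le_div_iff₀ (Real.log_pos (by norm_num))]
      have : 0 ≤ Real.log A.card := Real.log_natCast_nonneg _
      nlinarith [Real.log_two_lt_d9]
    have hDK : 2 * D ≤ K := by
      rw [hK]
      have := sq_nonneg (800 * C ^ 4 + D)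
      linarith
    have hK0 : 0 ≤ K := by linarith
    calc D * (((A.card : ℝ) + B.card) * (1 + Real.log A.card))
        ≤ D * (((A.card : ℝ) + B.card) * (2 * Real.logb 2 A.card)) := by
          gcongr; linarith
      _ = 2 * D * (A.card * Real.logb 2 A.card + B.card * Real.logb 2 A.card) := by ring
      _ ≤ K * ((A.card : ℝ) * Real.logb 2 B.card + B.card * Real.logb 2 A.card) := by gcongr
  intro A B hA hB
  rcases le_total A.card B.card with hAB | hAB
  · exact main A B hA hB hAB
  · refine ((main B A hB hA hAB).swap.congr ?_).mono (le_of_eq ?_) (le_of_eq ?_)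
    · exact fun a b => ⟨fun h => ⟨h.2.1, h.1, hrel _ _ h.2.2⟩,
        fun h => ⟨h.2.1, h.1, hrel _ _ h.2.2⟩⟩
    · rw [add_comm (A.card : ℝ)]; ring
    · rw [add_comm (A.card : ℝ)]; ring

section Sampling

variable {G : Type*} [Fintype G] [DecidableEq G]

/-- The probability that a random subset of `G`, containing each element independently with
probability `p`, equals `S`. -/
def sampleWeight (p : ℝ) (S : Finset G) : ℝ := p ^ S.card * (1 - p) ^ Sᶜ.card

theorem sampleWeight_nonneg {p : ℝ} (h0 : 0 ≤ p) (h1 : p ≤ 1) (S : Finset G) :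
    0 ≤ sampleWeight p S :=
  mul_nonneg (pow_nonneg h0 _) (pow_nonneg (by linarith) _)

theorem sum_sampleWeight_filter (p : ℝ) (D I : Finset G) :
    ∑ S : Finset G, (if D ⊆ S ∧ Disjoint I S then sampleWeight p S else 0) =
      if Disjoint D I then p ^ D.card * (1 - p) ^ I.card else 0 := by
  have h := Finset.prod_add (fun i => if i ∈ I then (0 : ℝ) else p)
    (fun i => if i ∈ D then 0 else 1 - p) Finset.univ
  rw [Finset.powerset_univ] at h
  have e1 : ∀ S : Finset G, (if D ⊆ S ∧ Disjoint I S then sampleWeight p S else 0) =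
      (∏ i ∈ S, if i ∈ I then (0 : ℝ) else p) * ∏ i ∈ Finset.univ \ S, if i ∈ D then 0 else 1 - p := by
    intro S
    split_ifs with hS
    · rw [sampleWeight, Finset.prod_congr rfl (g := fun _ => p), Finset.prod_const,
        Finset.prod_congr rfl (g := fun _ => 1 - p), Finset.prod_const, Finset.compl_eq_univ_sdiff]
      · intro i hi
        rw [if_neg]
        exact fun hiD => (Finset.mem_sdiff.1 hi).2 (hS.1 hiD)
      · intro i hi
        rw [if_neg]
        exact fun hiI => Finset.disjoint_left.1 hS.2 hiI hi
    · symm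
      rw [not_and_or] at hS
      rcases hS with hS | hS
      · obtain ⟨i, hiD, hiS⟩ := Finset.not_subset.1 hS
        refine mul_eq_zero_of_right _ (Finset.prod_eq_zero (i := i) (by simpa using hiS) ?_)
        exact if_pos hiD
      · obtain ⟨i, hiI, hiS⟩ := Finset.not_disjoint_iff.1 hS
        refine mul_eq_zero_of_left (Finset.prod_eq_zero hiS ?_) _
        exact if_pos hiI
  rw [Finset.sum_congr rfl fun S _ => e1 S, ← h]
  split_ifs with hDI
  · have e2 : ∀ i : G, ((if i ∈ I then (0 : ℝ) else p) + if i ∈ D then 0 else 1 - p) =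
        (if i ∈ D then p else 1) * if i ∈ I then 1 - p else 1 := by
      intro i
      have : i ∈ D → i ∉ I := fun h => Finset.disjoint_left.1 hDI h
      by_cases h1 : i ∈ D <;> by_cases h2 : i ∈ I <;> simp_all
    rw [Finset.prod_congr rfl fun i _ => e2 i, Finset.prod_mul_distrib]
    simp
  · obtain ⟨i, h1, h2⟩ := Finset.not_disjoint_iff.1 hDI
    exact Finset.prod_eq_zero (Finset.mem_univ i) (by simp [h1, h2])

theorem sum_sampleWeight (p : ℝ) : ∑ S : Finset G, sampleWeight p S = 1 := by
  simpa using sum_sampleWeight_filter p (∅ : Finset G) ∅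

theorem sum_sampleWeight_mul_sq_le {q : ℝ} (h0 : 0 ≤ q) :
    ∑ S : Finset G, sampleWeight q S * (1 + (S.card : ℝ)) ^ 2 ≤
      (1 + Fintype.card G * (2 * q)) ^ 2 := by
  have hsub : ∀ D : Finset G, ∑ S : Finset G, (if D ⊆ S then sampleWeight q S else 0) =
      q ^ D.card := by
    intro D
    simpa using sum_sampleWeight_filter q D ∅
  have e1 : ∀ S : Finset G, sampleWeight q S * (1 + (S.card : ℝ)) ^ 2 = sampleWeight q S +
      2 * ∑ i : G, (if {i} ⊆ S then sampleWeight q S else 0) +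
      ∑ i : G, ∑ j : G, (if {i, j} ⊆ S then sampleWeight q S else 0) := by
    intro S
    have hc : (S.card : ℝ) = ∑ i : G, if i ∈ S then (1 : ℝ) else 0 := by simp
    have a1 : ∑ i : G, (if {i} ⊆ S then sampleWeight q S else 0) = sampleWeight q S * S.card := by
      rw [hc, Finset.mul_sum]
      exact Finset.sum_congr rfl fun i _ => by simp
    have a2 : ∑ i : G, ∑ j : G, (if {i, j} ⊆ S then sampleWeight q S else 0) =
        sampleWeight q S * (S.card * S.card) := by
      rw [hc, Finset.sum_mul_sum, Finset.mul_sum]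
      refine Finset.sum_congr rfl fun i _ => ?_
      rw [Finset.mul_sum]
      refine Finset.sum_congr rfl fun j _ => ?_
      by_cases hi : i ∈ S <;> by_cases hj : j ∈ S <;> simp [Finset.insert_subset_iff, hi, hj]
    rw [a1, a2]
    ring
  rw [Finset.sum_congr rfl fun S _ => e1 S, Finset.sum_add_distrib, Finset.sum_add_distrib,
    sum_sampleWeight, ← Finset.mul_sum, Finset.sum_comm]
  have e2 : ∑ S : Finset G, ∑ i : G, ∑ j : G, (if {i, j} ⊆ S then sampleWeight q S else 0) =
      ∑ i : G, ∑ j : G, q ^ ({i, j} : Finset G).card := by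
    rw [Finset.sum_comm]
    refine Finset.sum_congr rfl fun i _ => ?_
    rw [Finset.sum_comm]
    exact Finset.sum_congr rfl fun j _ => hsub _
  rw [e2, Finset.sum_congr rfl fun i _ => hsub {i}]
  have e3 : ∑ i : G, ∑ j : G, q ^ ({i, j} : Finset G).card ≤
      ∑ i : G, ∑ j : G, (q ^ 2 + if i = j then q else 0) := by
    gcongr with i _ j _
    split_ifs with hij
    · subst hij
      simp only [Finset.pair_eq_singleton, Finset.card_singleton, pow_one]
      nlinarith
    · rw [Finset.card_pair hij, add_zero]
  have e4 : ∑ i : G, ∑ j : G, (q ^ 2 + if i = j then q else 0) =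
      (Fintype.card G : ℝ) ^ 2 * q ^ 2 + Fintype.card G * q := by
    simp [Finset.sum_add_distrib]
    ring
  simp only [Finset.card_singleton, pow_one, Finset.sum_const, Finset.card_univ, nsmul_eq_mul]
  have : 0 ≤ (Fintype.card G : ℝ) * q := by positivity
  nlinarith [mul_nonneg this this]

/-- A weighted form of the exponential decay lemma for random sampling. -/
theorem exists_sample {T : Type*} (U : Finset T) (D I : T → Finset G)
    (hD : ∀ τ ∈ U, (D τ).card ≤ 4) {c : ℝ} (hc : 0 ≤ c)
    (hU : ∀ S : Finset G, ((U.filter fun τ => D τ ⊆ S ∧ Disjoint (I τ) S).card : ℝ) ≤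
      c * (1 + (S.card : ℝ)) ^ 2) {q : ℝ} (hq0 : 0 < q) (hq1 : q ≤ 1 / 2) :
    ∃ S : Finset G, ∑ τ ∈ U.filter (fun τ => D τ ⊆ S ∧ Disjoint (I τ) S),
      (1 + q) ^ (I τ).card ≤ 16 * c * (1 + Fintype.card G * (2 * q)) ^ 2 := by
  by_contra! hcon
  have hlt : 16 * c * (1 + Fintype.card G * (2 * q)) ^ 2 <
      ∑ S : Finset G, sampleWeight (2 * q) S *
        ∑ τ ∈ U.filter (fun τ => D τ ⊆ S ∧ Disjoint (I τ) S), (1 + q) ^ (I τ).card := by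
    have hsum := sum_sampleWeight (G := G) (2 * q)
    calc 16 * c * (1 + Fintype.card G * (2 * q)) ^ 2
        = ∑ S : Finset G, sampleWeight (2 * q) S *
            (16 * c * (1 + Fintype.card G * (2 * q)) ^ 2) := by
          rw [← Finset.sum_mul, hsum, one_mul]
      _ < _ := by
          refine Finset.sum_lt_sum (fun S _ => mul_le_mul_of_nonneg_left (hcon S).le
            (sampleWeight_nonneg (by linarith) (by linarith) S)) ⟨Finset.univ, Finset.mem_univ _, ?_⟩
          refine mul_lt_mul_of_pos_left (hcon _) ?_
          simp only [sampleWeight, Finset.compl_univ, Finset.card_empty, pow_zero, mul_one]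
          positivity
  have hswap : ∀ (p : ℝ) (X : T → ℝ), ∑ S : Finset G, sampleWeight p S *
      ∑ τ ∈ U.filter (fun τ => D τ ⊆ S ∧ Disjoint (I τ) S), X τ =
      ∑ τ ∈ U, X τ * if Disjoint (D τ) (I τ) then p ^ (D τ).card * (1 - p) ^ (I τ).card else 0 := by
    intro p X
    simp_rw [Finset.sum_filter, Finset.mul_sum]
    rw [Finset.sum_comm]
    refine Finset.sum_congr rfl fun τ _ => ?_
    rw [← sum_sampleWeight_filter, Finset.mul_sum]
    refine Finset.sum_congr rfl fun S _ => ?_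
    split_ifs <;> ring
  have hle : ∑ S : Finset G, sampleWeight (2 * q) S *
        ∑ τ ∈ U.filter (fun τ => D τ ⊆ S ∧ Disjoint (I τ) S), (1 + q) ^ (I τ).card ≤
      16 * ∑ S : Finset G, sampleWeight q S *
        ∑ τ ∈ U.filter (fun τ => D τ ⊆ S ∧ Disjoint (I τ) S), 1 := by
    rw [hswap, hswap q fun _ => 1, Finset.mul_sum]
    refine Finset.sum_le_sum fun τ hτ => ?_
    split_ifs
    · have h1 : (2 : ℝ) ^ (D τ).card ≤ 16 := by
        calc (2 : ℝ) ^ (D τ).card ≤ 2 ^ 4 := pow_le_pow_right₀ (by norm_num) (hD τ hτ)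
          _ = 16 := by norm_num
      have h2 : ((1 + q) * (1 - 2 * q)) ^ (I τ).card ≤ (1 - q) ^ (I τ).card :=
        pow_le_pow_left₀ (mul_nonneg (by linarith) (by linarith)) (by nlinarith) _
      have h3 : 0 ≤ ((1 + q) * (1 - 2 * q)) ^ (I τ).card :=
        pow_nonneg (mul_nonneg (by linarith) (by linarith)) _
      calc (1 + q) ^ (I τ).card * ((2 * q) ^ (D τ).card * (1 - 2 * q) ^ (I τ).card)
          = 2 ^ (D τ).card * q ^ (D τ).card * ((1 + q) * (1 - 2 * q)) ^ (I τ).card := by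
            rw [mul_pow, mul_pow]; ring
        _ ≤ 16 * q ^ (D τ).card * (1 - q) ^ (I τ).card := by gcongr
        _ = _ := by ring
    · simp
  have hfin : ∑ S : Finset G, sampleWeight q S *
        ∑ τ ∈ U.filter (fun τ => D τ ⊆ S ∧ Disjoint (I τ) S), (1 : ℝ) ≤
      c * (1 + Fintype.card G * (2 * q)) ^ 2 := by
    calc _ ≤ ∑ S : Finset G, sampleWeight q S * (c * (1 + (S.card : ℝ)) ^ 2) := by
          refine Finset.sum_le_sum fun S _ => mul_le_mul_of_nonneg_left ?_
            (sampleWeight_nonneg hq0.le (by linarith) S)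
          simpa using hU S
      _ = c * ∑ S : Finset G, sampleWeight q S * (1 + (S.card : ℝ)) ^ 2 := by
          rw [Finset.mul_sum]
          exact Finset.sum_congr rfl fun S _ => by ring
      _ ≤ _ := mul_le_mul_of_nonneg_left (sum_sampleWeight_mul_sq_le hq0.le) hc
  linarith

end Sampling

/-- A finite family of graphs of continuous functions, any two of which meet finitely often,
lying between the two graphs indexed by `Sum.inr false` and `Sum.inr true`. -/
structure CurveSystem (G : Type*) where
  cv : G ⊕ Bool → ℝ → ℝ
  xmin : ℝ
  xmax : ℝ
  K : ℕ
  meeting : G → G ⊕ Bool → Finset ℝ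
  continuous_cv : ∀ e, Continuous (cv e)
  lo_lt : ∀ e, e ≠ Sum.inr false → ∀ x, cv (Sum.inr false) x < cv e x
  lt_hi : ∀ e, e ≠ Sum.inr true → ∀ x, cv e x < cv (Sum.inr true) x
  mem_meeting : ∀ g e x, Sum.inl g ≠ e → cv (Sum.inl g) x = cv e x → x ∈ meeting g e
  card_meeting : ∀ g e, (meeting g e).card ≤ K

/-- A vertical pseudo-trapezoid, together with the curves that delimit it. -/
@[ext]
structure Trapezoid (G : Type*) where
  bot : G ⊕ Bool
  top : G ⊕ Bool
  gl : Option G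
  gr : Option G
  l : ℝ
  r : ℝ

def Trapezoid.Defines {G : Type*} (τ : Trapezoid G) (g : G) : Prop :=
  τ.bot = Sum.inl g ∨ τ.top = Sum.inl g ∨ τ.gl = some g ∨ τ.gr = some g

theorem lt_on_Ioo_of_ne {u v : ℝ → ℝ} (hu : Continuous u) (hv : Continuous v) {l r p : ℝ}
    (hne : ∀ x ∈ Set.Ioo l r, u x ≠ v x) (hp : p ∈ Set.Ioo l r) (h : u p < v p) :
    ∀ x ∈ Set.Ioo l r, u x < v x := by
  intro x hx
  by_contra! hcon
  obtain ⟨y, hy, hyy⟩ := isPreconnected_Ioo.intermediate_value₂ hp hx hu.continuousOn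
    hv.continuousOn h.le hcon
  exact hne y hy hyy

namespace CurveSystem

variable {G : Type*} (Φ : CurveSystem G)

def Meets (τ : Trapezoid G) (g : G) (x : ℝ) : Prop :=
  (Sum.inl g ≠ τ.bot ∧ Φ.cv (Sum.inl g) x = Φ.cv τ.bot x) ∨
    (Sum.inl g ≠ τ.top ∧ Φ.cv (Sum.inl g) x = Φ.cv τ.top x)

structure Valid (τ : Trapezoid G) : Prop where
  lt : τ.l < τ.r
  le_xmax : τ.r ≤ Φ.xmax
  bot_lt_top : ∀ x ∈ Set.Ioo τ.l τ.r, Φ.cv τ.bot x < Φ.cv τ.top x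
  left_none : τ.gl = none → τ.l = Φ.xmin
  left_some : ∀ g, τ.gl = some g → Φ.Meets τ g τ.l
  right_none : τ.gr = none → τ.r = Φ.xmax
  right_some : ∀ g, τ.gr = some g → τ.r < Φ.xmax ∧ Φ.Meets τ g τ.r

def Conflict [LT G] (τ : Trapezoid G) (g : G) : Prop :=
  (Sum.inl g ≠ τ.bot ∧ Sum.inl g ≠ τ.top ∧ ∃ x ∈ Set.Ioo τ.l τ.r,
    Φ.cv τ.bot x ≤ Φ.cv (Sum.inl g) x ∧ Φ.cv (Sum.inl g) x ≤ Φ.cv τ.top x) ∨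
  ∃ g₀, τ.gr = some g₀ ∧ g < g₀ ∧ Φ.Meets τ g τ.r

def Mem (τ : Trapezoid G) (x y : ℝ) : Prop :=
  x ∈ Set.Ioo τ.l τ.r ∧ Φ.cv τ.bot x < y ∧ y ≤ Φ.cv τ.top x

variable {Φ}

theorem outside_of_not_conflict [LT G] {τ : Trapezoid G} {S : Finset G}
    (hI : ∀ g ∈ S, ¬ Φ.Conflict τ g) {e : G ⊕ Bool} (he : ∀ g, e = Sum.inl g → g ∈ S)
    (hb : e ≠ τ.bot) (ht : e ≠ τ.top) {x : ℝ} (hx : x ∈ Set.Ioo τ.l τ.r) :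
    Φ.cv e x < Φ.cv τ.bot x ∨ Φ.cv τ.top x < Φ.cv e x := by
  rcases e with g | e
  · by_contra! h
    exact hI g (he g rfl) (Or.inl ⟨hb, ht, x, hx, h.1, h.2⟩)
  · cases e
    · exact Or.inl (Φ.lo_lt _ hb.symm x)
    · exact Or.inr (Φ.lt_hi _ ht.symm x)

theorem le_iff_of_not_conflict [LT G] {τ : Trapezoid G} (hτ : Φ.Valid τ) {g : G}
    (hg : ¬ Φ.Conflict τ g)
    {x y x' y' : ℝ} (h : Φ.Mem τ x y) (h' : Φ.Mem τ x' y') :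
    y ≤ Φ.cv (Sum.inl g) x ↔ y' ≤ Φ.cv (Sum.inl g) x' := by
  obtain ⟨hx, hb, ht⟩ := h
  obtain ⟨hx', hb', ht'⟩ := h'
  by_cases e1 : Sum.inl g = τ.bot
  · rw [e1]
    exact ⟨fun h => absurd h hb.not_ge, fun h => absurd h hb'.not_ge⟩
  by_cases e2 : Sum.inl g = τ.top
  · rw [e2]
    exact ⟨fun _ => ht', fun _ => ht⟩
  have key : ∀ z ∈ Set.Ioo τ.l τ.r,
      Φ.cv (Sum.inl g) z < Φ.cv τ.bot z ∨ Φ.cv τ.top z < Φ.cv (Sum.inl g) z := fun z hz =>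
    outside_of_not_conflict (S := {g}) (by simpa using hg) (by simp) e1 e2 hz
  have hbt : ∀ z ∈ Set.Ioo τ.l τ.r, Φ.cv (Sum.inl g) z ≠ Φ.cv τ.bot z ∧
      Φ.cv τ.top z ≠ Φ.cv (Sum.inl g) z := by
    intro z hz
    rcases key z hz with h | h
    · exact ⟨h.ne, (h.trans (hτ.bot_lt_top z hz)).ne'⟩
    · exact ⟨((hτ.bot_lt_top z hz).trans h).ne', h.ne⟩
  have hc := Φ.continuous_cv
  rcases key x hx with h | h
  · have h' := lt_on_Ioo_of_ne (hc _) (hc _) (fun z hz => (hbt z hz).1) hx h x' hx'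
    exact ⟨fun k => absurd k (h.trans hb).not_ge, fun k => absurd k (h'.trans hb').not_ge⟩
  · have h' := lt_on_Ioo_of_ne (hc _) (hc _) (fun z hz => (hbt z hz).2) hx h x' hx'
    exact ⟨fun _ => ht'.trans h'.le, fun _ => ht.trans h.le⟩

theorem eq_of_bot_eq [LinearOrder G] {S : Finset G} {τ τ' : Trapezoid G} (hτ : Φ.Valid τ)
    (hτ' : Φ.Valid τ') (hD : ∀ g, τ.Defines g → g ∈ S) (hD' : ∀ g, τ'.Defines g → g ∈ S)
    (hI : ∀ g ∈ S, ¬ Φ.Conflict τ g) (hI' : ∀ g ∈ S, ¬ Φ.Conflict τ' g)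
    (hl : τ.l = τ'.l) (hb : τ.bot = τ'.bot) : τ.top = τ'.top := by
  obtain ⟨x, hx1, hx2⟩ := exists_between (lt_min hτ.lt (hl ▸ hτ'.lt : τ.l < τ'.r))
  have hx : x ∈ Set.Ioo τ.l τ.r := ⟨hx1, hx2.trans_le (min_le_left _ _)⟩
  have hx' : x ∈ Set.Ioo τ'.l τ'.r := ⟨hl ▸ hx1, hx2.trans_le (min_le_right _ _)⟩
  have h1 := hτ.bot_lt_top x hx
  have h2 := hτ'.bot_lt_top x hx'
  by_contra hne
  have a1 := outside_of_not_conflict hI (e := τ'.top)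
    (fun g hg => hD' g (Or.inr (Or.inl hg))) (fun h => by rw [h, hb] at h2; exact h2.false)
    (Ne.symm hne) hx
  have a2 := outside_of_not_conflict hI' (e := τ.top)
    (fun g hg => hD g (Or.inr (Or.inl hg))) (fun h => by rw [h, hb] at h1; exact h1.false)
    hne hx'
  rw [hb] at a1 h1
  rcases a1 with a1 | a1 <;> rcases a2 with a2 | a2 <;> linarith

theorem eq_of_top_eq [LinearOrder G] {S : Finset G} {τ τ' : Trapezoid G} (hτ : Φ.Valid τ)
    (hτ' : Φ.Valid τ') (hD : ∀ g, τ.Defines g → g ∈ S) (hD' : ∀ g, τ'.Defines g → g ∈ S)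
    (hI : ∀ g ∈ S, ¬ Φ.Conflict τ g) (hI' : ∀ g ∈ S, ¬ Φ.Conflict τ' g)
    (hl : τ.l = τ'.l) (ht : τ.top = τ'.top) : τ.bot = τ'.bot := by
  obtain ⟨x, hx1, hx2⟩ := exists_between (lt_min hτ.lt (hl ▸ hτ'.lt : τ.l < τ'.r))
  have hx : x ∈ Set.Ioo τ.l τ.r := ⟨hx1, hx2.trans_le (min_le_left _ _)⟩
  have hx' : x ∈ Set.Ioo τ'.l τ'.r := ⟨hl ▸ hx1, hx2.trans_le (min_le_right _ _)⟩
  have h1 := hτ.bot_lt_top x hx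
  have h2 := hτ'.bot_lt_top x hx'
  by_contra hne
  have a1 := outside_of_not_conflict hI (e := τ'.bot) (fun g hg => hD' g (Or.inl hg))
    (Ne.symm hne) (fun h => by rw [h, ht] at h2; exact h2.false) hx
  have a2 := outside_of_not_conflict hI' (e := τ.bot) (fun g hg => hD g (Or.inl hg))
    hne (fun h => by rw [h, ht] at h1; exact h1.false) hx'
  rw [ht] at a1 h1
  rcases a1 with a1 | a1 <;> rcases a2 with a2 | a2 <;> linarith

theorem not_r_lt [LinearOrder G] {S : Finset G} {τ τ' : Trapezoid G} (hτ : Φ.Valid τ)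
    (hτ' : Φ.Valid τ') (hD : ∀ g, τ.Defines g → g ∈ S)
    (hI' : ∀ g ∈ S, ¬ Φ.Conflict τ' g)
    (hl : τ.l = τ'.l) (hb : τ.bot = τ'.bot) (ht : τ.top = τ'.top) : ¬ τ.r < τ'.r := by
  intro hlt
  have hr : τ.r ∈ Set.Ioo τ'.l τ'.r := ⟨hl ▸ hτ.lt, hlt⟩
  cases hgr : τ.gr with
  | none => exact absurd (hτ.right_none hgr) (hlt.trans_le hτ'.le_xmax).ne
  | some g =>
    have hlt' := hτ'.bot_lt_top _ hr
    have hc := hI' g (hD g (Or.inr (Or.inr (Or.inr hgr))))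
    rcases (hτ.right_some g hgr).2 with ⟨h1, h2⟩ | ⟨h1, h2⟩
    · rw [hb] at h1 h2
      exact hc (Or.inl ⟨h1, fun h => by rw [h] at h2; exact hlt'.ne' h2, _, hr, h2.ge,
        (h2.trans_lt hlt').le⟩)
    · rw [ht] at h1 h2
      exact hc (Or.inl ⟨fun h => by rw [h] at h2; exact hlt'.ne h2, h1, _, hr,
        (hlt'.trans_eq h2.symm).le, h2.le⟩)

theorem eq_of_eq [LinearOrder G] {S : Finset G} {τ τ' : Trapezoid G} (hτ : Φ.Valid τ)
    (hτ' : Φ.Valid τ') (hD : ∀ g, τ.Defines g → g ∈ S) (hD' : ∀ g, τ'.Defines g → g ∈ S)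
    (hI : ∀ g ∈ S, ¬ Φ.Conflict τ g) (hI' : ∀ g ∈ S, ¬ Φ.Conflict τ' g)
    (hl : τ.l = τ'.l) (hb : τ.bot = τ'.bot) (ht : τ.top = τ'.top) (hgl : τ.gl = τ'.gl) :
    τ = τ' := by
  have hr : τ.r = τ'.r := le_antisymm
    (not_lt.1 (not_r_lt hτ' hτ hD' hI hl.symm hb.symm ht.symm))
    (not_lt.1 (not_r_lt hτ hτ' hD hI' hl hb ht))
  have hm : ∀ g x, Φ.Meets τ g x ↔ Φ.Meets τ' g x := by
    intro g x
    rw [Meets, Meets, hb, ht]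
  refine Trapezoid.ext hb ht hgl ?_ hl hr
  cases h : τ.gr with
  | none =>
    cases h' : τ'.gr with
    | none => rfl
    | some g' =>
      exact absurd (hτ.right_none h) (hr ▸ (hτ'.right_some g' h').1.ne)
  | some g =>
    have h1 := hτ.right_some g h
    cases h' : τ'.gr with
    | none => exact absurd (hτ'.right_none h') (hr ▸ h1.1.ne)
    | some g' =>
      have h2 := hτ'.right_some g' h'
      rcases lt_trichotomy g g' with hlt | rfl | hlt
      · exact absurd (Or.inr ⟨g', h', hlt, (hm _ _).1 (hr ▸ h1.2)⟩)
          (hI' g (hD g (Or.inr (Or.inr (Or.inr h)))))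
      · rfl
      · exact absurd (Or.inr ⟨g, h, hlt, (hm _ _).2 (hr ▸ h2.2)⟩)
          (hI g' (hD' g' (Or.inr (Or.inr (Or.inr h')))))

end CurveSystem

namespace CurveSystem

open Classical in
noncomputable def _root_.Trapezoid.defining {G : Type*} [Fintype G] (τ : Trapezoid G) : Finset G :=
  Finset.univ.filter τ.Defines

open Classical in
noncomputable def conflicts {G : Type*} [Fintype G] [LT G] (Φ : CurveSystem G)
    (τ : Trapezoid G) : Finset G :=
  Finset.univ.filter (Φ.Conflict τ)

theorem _root_.Trapezoid.card_defining_le {G : Type*} [Fintype G] (τ : Trapezoid G) :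
    τ.defining.card ≤ 4 := by
  classical
  have : τ.defining ⊆ τ.bot.getLeft?.toFinset ∪ τ.top.getLeft?.toFinset ∪
      (τ.gl.toFinset ∪ τ.gr.toFinset) := by
    intro g hg
    simp only [Trapezoid.defining, Finset.mem_filter, Trapezoid.Defines] at hg
    simp only [Finset.mem_union, Option.mem_toFinset, Option.mem_def, Sum.getLeft?_eq_some_iff]
    tauto
  have h1 : ∀ o : Option G, o.toFinset.card ≤ 1 := by
    intro o
    cases o <;> simp
  refine (Finset.card_le_card this).trans ((Finset.card_union_le _ _).trans ?_)
  have h2 := Finset.card_union_le τ.bot.getLeft?.toFinset τ.top.getLeft?.toFinset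
  have h3 := Finset.card_union_le τ.gl.toFinset τ.gr.toFinset
  have := h1 τ.bot.getLeft?
  have := h1 τ.top.getLeft?
  have := h1 τ.gl
  have := h1 τ.gr
  omega

variable {G : Type*} {Φ : CurveSystem G}

theorem mem_disjSum_univ {S : Finset G} {e : G ⊕ Bool} (h : ∀ g, e = Sum.inl g → g ∈ S) :
    e ∈ S.disjSum Finset.univ := by
  rcases e with g | e
  · exact Finset.inl_mem_disjSum.2 (h g rfl)
  · exact Finset.inr_mem_disjSum.2 (Finset.mem_univ e)

theorem card_le_of_key {S : Finset G} (W : Finset (Trapezoid G)) (e : Trapezoid G → G ⊕ Bool)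
    (hS : ∀ τ ∈ W, ∀ g, e τ = Sum.inl g → g ∈ S)
    (hW : ∀ τ ∈ W, ∃ g ∈ S, τ.gl = some g ∧ τ.l ∈ Φ.meeting g (e τ))
    (hinj : ∀ τ ∈ W, ∀ τ' ∈ W, τ.l = τ'.l → e τ = e τ' → τ.gl = τ'.gl → τ = τ') :
    W.card ≤ Φ.K * (S.card * (S.card + 2)) := by
  classical
  have h1 : W.card ≤ (((S ×ˢ S.disjSum Finset.univ).sigma fun p => Φ.meeting p.1 p.2).image
      fun s => (some s.1.1, s.1.2, s.2)).card := by
    refine Finset.card_le_card_of_injOn (fun τ => (τ.gl, e τ, τ.l)) ?_ ?_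
    · intro τ hτ
      obtain ⟨g, hg, h1, h2⟩ := hW τ hτ
      refine Finset.mem_coe.2 (Finset.mem_image.2 ⟨⟨(g, e τ), τ.l⟩, ?_, by simp [h1]⟩)
      simp only [Finset.mem_sigma, Finset.mem_product]
      exact ⟨⟨hg, mem_disjSum_univ (hS τ hτ)⟩, h2⟩
    · intro τ hτ τ' hτ' h
      simp only [Prod.mk.injEq] at h
      exact hinj τ hτ τ' hτ' h.2.2 h.2.1 h.1
  refine h1.trans (Finset.card_image_le.trans ?_)
  rw [Finset.card_sigma]
  refine (Finset.sum_le_card_nsmul _ _ _ fun p _ => Φ.card_meeting p.1 p.2).trans (le_of_eq ?_)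
  simp [Finset.card_product, Finset.card_disjSum]
  ring

theorem card_filter_le [Fintype G] [LinearOrder G] (U : Finset (Trapezoid G))
    (hU : ∀ τ ∈ U, Φ.Valid τ) (S : Finset G) :
    ((U.filter fun τ => τ.defining ⊆ S ∧ Disjoint (Φ.conflicts τ) S).card : ℝ) ≤
      (2 + 2 * Φ.K) * (1 + (S.card : ℝ)) ^ 2 := by
  classical
  obtain ⟨W, hW⟩ : ∃ W, W = U.filter fun τ => τ.defining ⊆ S ∧ Disjoint (Φ.conflicts τ) S :=
    ⟨_, rfl⟩
  rw [← hW]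
  have hval : ∀ τ ∈ W, Φ.Valid τ := fun τ hτ => hU τ (Finset.mem_filter.1 (hW ▸ hτ)).1
  have hD : ∀ τ ∈ W, ∀ g, τ.Defines g → g ∈ S := fun τ hτ g hg =>
    (Finset.mem_filter.1 (hW ▸ hτ)).2.1 (Finset.mem_filter.2 ⟨Finset.mem_univ _, hg⟩)
  have hI : ∀ τ ∈ W, ∀ g ∈ S, ¬ Φ.Conflict τ g := fun τ hτ g hg h =>
    Finset.disjoint_left.1 (Finset.mem_filter.1 (hW ▸ hτ)).2.2
      (Finset.mem_filter.2 ⟨Finset.mem_univ _, h⟩) hg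
  have eb : ∀ τ ∈ W, ∀ τ' ∈ W, τ.l = τ'.l → τ.bot = τ'.bot → τ.gl = τ'.gl → τ = τ' := by
    intro τ hτ τ' hτ' hl hb hgl
    exact eq_of_eq (hval τ hτ) (hval τ' hτ') (hD τ hτ) (hD τ' hτ') (hI τ hτ) (hI τ' hτ') hl hb
      (eq_of_bot_eq (hval τ hτ) (hval τ' hτ') (hD τ hτ) (hD τ' hτ') (hI τ hτ) (hI τ' hτ') hl hb) hgl
  have et : ∀ τ ∈ W, ∀ τ' ∈ W, τ.l = τ'.l → τ.top = τ'.top → τ.gl = τ'.gl → τ = τ' := by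
    intro τ hτ τ' hτ' hl ht hgl
    exact eb τ hτ τ' hτ' hl (eq_of_top_eq (hval τ hτ) (hval τ' hτ') (hD τ hτ) (hD τ' hτ')
      (hI τ hτ) (hI τ' hτ') hl ht) hgl
  obtain ⟨W₀, hW₀⟩ : ∃ W₀, W₀ = W.filter fun τ => τ.gl = none := ⟨_, rfl⟩
  obtain ⟨W₁, hW₁⟩ : ∃ W₁, W₁ = W.filter fun τ => ∃ g ∈ S, τ.gl = some g ∧ τ.l ∈ Φ.meeting g τ.bot :=
    ⟨_, rfl⟩
  obtain ⟨W₂, hW₂⟩ : ∃ W₂, W₂ = W.filter fun τ => ∃ g ∈ S, τ.gl = some g ∧ τ.l ∈ Φ.meeting g τ.top :=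
    ⟨_, rfl⟩
  have hcov : W ⊆ W₀ ∪ (W₁ ∪ W₂) := by
    intro τ hτ
    rw [hW₀, hW₁, hW₂]
    simp only [Finset.mem_union, Finset.mem_filter, hτ, true_and]
    cases h : τ.gl with
    | none => exact Or.inl rfl
    | some g =>
      have hg := hD τ hτ g (Or.inr (Or.inr (Or.inl h)))
      rcases (hval τ hτ).left_some g h with ⟨h1, h2⟩ | ⟨h1, h2⟩
      · exact Or.inr (Or.inl ⟨g, hg, rfl, Φ.mem_meeting _ _ _ h1 h2⟩)
      · exact Or.inr (Or.inr ⟨g, hg, rfl, Φ.mem_meeting _ _ _ h1 h2⟩)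
  have c0 : W₀.card ≤ S.card + 2 := by
    have : W₀.card ≤ (S.disjSum (Finset.univ : Finset Bool)).card := by
      refine Finset.card_le_card_of_injOn Trapezoid.bot ?_ ?_
      · intro τ hτ
        have hτ := (Finset.mem_filter.1 (hW₀ ▸ hτ)).1
        exact mem_disjSum_univ fun g hg => hD τ hτ g (Or.inl hg)
      · intro τ hτ τ' hτ' h
        have hτ := Finset.mem_filter.1 (hW₀ ▸ hτ)
        have hτ' := Finset.mem_filter.1 (hW₀ ▸ hτ')
        refine eb τ hτ.1 τ' hτ'.1 ?_ h (hτ.2.trans hτ'.2.symm)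
        rw [(hval τ hτ.1).left_none hτ.2, (hval τ' hτ'.1).left_none hτ'.2]
    simpa [Finset.card_disjSum] using this
  have c1 : W₁.card ≤ Φ.K * (S.card * (S.card + 2)) := by
    have m := fun τ (h : τ ∈ W₁) => Finset.mem_filter.1 (hW₁ ▸ h)
    exact card_le_of_key W₁ Trapezoid.bot (fun τ hτ g hg => hD τ (m τ hτ).1 g (Or.inl hg))
      (fun τ hτ => (m τ hτ).2) (fun τ hτ τ' hτ' => eb τ (m τ hτ).1 τ' (m τ' hτ').1)
  have c2 : W₂.card ≤ Φ.K * (S.card * (S.card + 2)) := by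
    have m := fun τ (h : τ ∈ W₂) => Finset.mem_filter.1 (hW₂ ▸ h)
    exact card_le_of_key W₂ Trapezoid.top
      (fun τ hτ g hg => hD τ (m τ hτ).1 g (Or.inr (Or.inl hg)))
      (fun τ hτ => (m τ hτ).2) (fun τ hτ τ' hτ' => et τ (m τ hτ).1 τ' (m τ' hτ').1)
  have c3 : W.card ≤ (S.card + 2) + 2 * (Φ.K * (S.card * (S.card + 2))) := by
    have := (Finset.card_le_card hcov).trans (Finset.card_union_le _ _)
    have := Finset.card_union_le W₁ W₂
    omega
  have c4 : (W.card : ℝ) ≤ (S.card + 2) + 2 * (Φ.K * (S.card * (S.card + 2))) := by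
    exact_mod_cast c3
  have : (0 : ℝ) ≤ S.card := by positivity
  have : (0 : ℝ) ≤ Φ.K := by positivity
  nlinarith

end CurveSystem

theorem exists_last_event {G : Type*} (P : G → ℝ → Prop) (hP : {z | ∃ g, P g z}.Finite)
    {x₀ x : ℝ} (hx : x₀ < x) : ∃ (l : ℝ) (o : Option G), l < x ∧
      (∀ z, l < z → z < x → ∀ g, ¬ P g z) ∧ (o = none → l = x₀) ∧ ∀ g, o = some g → P g l := by
  classical
  by_cases hne : (hP.toFinset.filter fun z => x₀ < z ∧ z < x).Nonempty
  · obtain ⟨l, hl, hmax⟩ := Finset.exists_max_image _ id hne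
    simp only [Finset.mem_filter, Set.Finite.mem_toFinset, Set.mem_ofPred_eq] at hl hmax
    obtain ⟨⟨g, hg⟩, h1, h2⟩ := hl
    refine ⟨l, some g, h2, fun z hz hzx g' hg' => ?_, by simp, fun g' hg' => ?_⟩
    · exact hz.not_ge (hmax z ⟨⟨g', hg'⟩, h1.trans hz, hzx⟩)
    · rwa [← Option.some.inj hg']
  · refine ⟨x₀, none, hx, fun z hz hzx g hg => hne ⟨z, ?_⟩, fun _ => rfl, by simp⟩
    simp only [Finset.mem_filter, Set.Finite.mem_toFinset, Set.mem_ofPred_eq]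
    exact ⟨⟨g, hg⟩, hz, hzx⟩

theorem exists_first_event {G : Type*} [LinearOrder G] (S : Finset G) (P : G → ℝ → Prop)
    (hP : {z | ∃ g ∈ S, P g z}.Finite) {x x₁ : ℝ} (hx : x < x₁) :
    ∃ (r : ℝ) (o : Option G), x < r ∧ r ≤ x₁ ∧
      (∀ z, x < z → z < r → ∀ g ∈ S, ¬ P g z) ∧ (o = none → r = x₁) ∧
      ∀ g, o = some g → g ∈ S ∧ r < x₁ ∧ P g r ∧ ∀ g' ∈ S, g' < g → ¬ P g' r := by
  classical
  by_cases hne : (hP.toFinset.filter fun z => x < z ∧ z < x₁).Nonempty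
  · obtain ⟨r, hr, hmin⟩ := Finset.exists_min_image _ id hne
    simp only [Finset.mem_filter, Set.Finite.mem_toFinset, Set.mem_ofPred_eq] at hr hmin
    obtain ⟨⟨g₁, hg₁, hg₁'⟩, h1, h2⟩ := hr
    obtain ⟨g, hg, hgmin⟩ := Finset.exists_min_image (S.filter fun g => P g r) id
      ⟨g₁, Finset.mem_filter.2 ⟨hg₁, hg₁'⟩⟩
    simp only [Finset.mem_filter] at hg hgmin
    refine ⟨r, some g, h1, h2.le, fun z hz hzx g' hgS hg' => ?_, by simp, fun g' hg' => ?_⟩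
    · exact hzx.not_ge (hmin z ⟨⟨g', hgS, hg'⟩, hz, hzx.trans h2⟩)
    · rw [← Option.some.inj hg']
      exact ⟨hg.1, h2, hg.2, fun g'' h h' h'' => h'.not_ge (hgmin g'' ⟨h, h''⟩)⟩
  · refine ⟨x₁, none, hx, le_rfl, fun z hz hzx g hgS hg => hne ⟨z, ?_⟩, fun _ => rfl, by simp⟩
    simp only [Finset.mem_filter, Set.Finite.mem_toFinset, Set.mem_ofPred_eq]
    exact ⟨⟨g, hgS, hg⟩, hz, hzx⟩

theorem CurveSystem.exists_trapezoid {G : Type*} [LinearOrder G] (Φ : CurveSystem G)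
    (S : Finset G) {x y : ℝ} (hx₀ : Φ.xmin < x) (hx₁ : x < Φ.xmax)
    (hlo : Φ.cv (Sum.inr false) x < y) (hhi : y ≤ Φ.cv (Sum.inr true) x)
    (hd : ∀ e e', e ≠ e' → Φ.cv e x ≠ Φ.cv e' x) :
    ∃ τ : Trapezoid G, Φ.Valid τ ∧ Φ.Mem τ x y ∧ (∀ g, τ.Defines g → g ∈ S) ∧
      ∀ g ∈ S, ¬ Φ.Conflict τ g := by
  classical
  obtain ⟨b, hb, hbmax⟩ := Finset.exists_max_image
    ((S.disjSum (Finset.univ : Finset Bool)).filter fun e => Φ.cv e x < y) (fun e => Φ.cv e x)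
    ⟨Sum.inr false, by simpa using hlo⟩
  obtain ⟨t, ht, htmin⟩ := Finset.exists_min_image
    ((S.disjSum (Finset.univ : Finset Bool)).filter fun e => y ≤ Φ.cv e x) (fun e => Φ.cv e x)
    ⟨Sum.inr true, by simpa using hhi⟩
  simp only [Finset.mem_filter] at hb hbmax ht htmin
  have hbS : ∀ g, b = Sum.inl g → g ∈ S := fun g hg => by simpa [hg] using hb.1
  have htS : ∀ g, t = Sum.inl g → g ∈ S := fun g hg => by simpa [hg] using ht.1
  obtain ⟨P, hP⟩ : ∃ P : G → ℝ → Prop, P = fun g z =>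
      (Sum.inl g ≠ b ∧ Φ.cv (Sum.inl g) z = Φ.cv b z) ∨
      (Sum.inl g ≠ t ∧ Φ.cv (Sum.inl g) z = Φ.cv t z) := ⟨_, rfl⟩
  have hfin : {z | ∃ g ∈ S, P g z}.Finite := by
    refine (S.biUnion fun g => Φ.meeting g b ∪ Φ.meeting g t).finite_toSet.subset ?_
    rintro z ⟨g, hg, hz⟩
    simp only [Finset.coe_biUnion, Set.mem_iUnion, Finset.mem_coe, Finset.mem_union]
    rw [hP] at hz
    exact ⟨g, hg, hz.imp (fun h => Φ.mem_meeting _ _ _ h.1 h.2)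
      fun h => Φ.mem_meeting _ _ _ h.1 h.2⟩
  have hPx : ∀ g, ¬ P g x := by
    intro g hg
    rw [hP] at hg
    exact hg.elim (fun h => hd _ _ h.1 h.2) fun h => hd _ _ h.1 h.2
  obtain ⟨l, gl, hl, hlno, hlnone, hlsome⟩ := exists_last_event (fun g z => g ∈ S ∧ P g z)
    (hfin.subset fun z hz => hz) hx₀
  obtain ⟨r, gr, hr, hr₁, hrno, hrnone, hrsome⟩ := exists_first_event S P hfin hx₁
  have hno : ∀ z ∈ Set.Ioo l r, ∀ g ∈ S, ¬ P g z := by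
    intro z hz g hg hPg
    rcases lt_trichotomy z x with h | rfl | h
    · exact hlno z hz.1 h g ⟨hg, hPg⟩
    · exact hPx g hPg
    · exact hrno z h hz.2 g hg hPg
  have hxlr : x ∈ Set.Ioo l r := ⟨hl, hr⟩
  have hbt : ∀ z ∈ Set.Ioo l r, Φ.cv b z < Φ.cv t z := by
    refine lt_on_Ioo_of_ne (Φ.continuous_cv _) (Φ.continuous_cv _) (fun z hz h => ?_) hxlr
      (hb.2.trans_le ht.2)
    have hne : b ≠ t := by
      rintro rfl
      exact hb.2.not_ge ht.2
    rcases hb' : b with g | e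
    · refine hno z hz g (hbS g hb') ?_
      rw [hP]
      exact Or.inr ⟨hb' ▸ hne, hb' ▸ h⟩
    · rcases ht' : t with g | e'
      · refine hno z hz g (htS g ht') ?_
        rw [hP]
        exact Or.inl ⟨ht' ▸ hne.symm, ht' ▸ h.symm⟩
      · cases e
        · exact (Φ.lo_lt t (by rw [← hb']; exact hne.symm) z).ne (hb' ▸ h)
        · exact (Φ.lt_hi t (by rw [← hb']; exact hne.symm) z).ne (hb' ▸ h.symm)
  refine ⟨⟨b, t, gl, gr, l, r⟩, ⟨hl.trans hr, hr₁, hbt, hlnone, ?_, hrnone, ?_⟩,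
    ⟨hxlr, hb.2, ht.2⟩, ?_, ?_⟩
  · intro g hg
    have := (hlsome g hg).2
    rwa [hP] at this
  · intro g hg
    have := hrsome g hg
    rw [hP] at this
    exact ⟨this.2.1, this.2.2.1⟩
  · rintro g (h | h | h | h)
    · exact hbS g h
    · exact htS g h
    · exact (hlsome g h).1
    · exact (hrsome g h).1
  · intro g hg hc
    rcases hc with ⟨hgb, hgt, z, hz, h1, h2⟩ | ⟨g₀, h0, hlt, hm⟩
    · have hc := Φ.continuous_cv
      have hne : ∀ z ∈ Set.Ioo l r, Φ.cv (Sum.inl g) z ≠ Φ.cv b z ∧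
          Φ.cv t z ≠ Φ.cv (Sum.inl g) z := by
        intro z hz
        have := hno z hz g hg
        rw [hP] at this
        exact ⟨fun h => this (Or.inl ⟨hgb, h⟩), fun h => this (Or.inr ⟨hgt, h.symm⟩)⟩
      have hgE : Sum.inl g ∈ S.disjSum (Finset.univ : Finset Bool) :=
        Finset.inl_mem_disjSum.2 hg
      rcases lt_or_ge (Φ.cv (Sum.inl g) x) y with hgy | hgy
      · have h3 := (hbmax _ ⟨hgE, hgy⟩).lt_of_ne (hd _ _ hgb)
        exact h1.not_gt (lt_on_Ioo_of_ne (hc _) (hc _) (fun z hz => (hne z hz).1) hxlr h3 z hz)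
      · have h3 := (htmin _ ⟨hgE, hgy⟩).lt_of_ne (hd _ _ (Ne.symm hgt))
        exact h2.not_gt (lt_on_Ioo_of_ne (hc _) (hc _) (fun z hz => (hne z hz).2) hxlr h3 z hz)
    · have := (hrsome g₀ h0).2.2.2 g hg hlt
      rw [hP] at this
      exact this hm

/-- Random sampling applied to the trapezoidal decompositions of a curve system. -/
theorem CurveSystem.exists_cutting {G V : Type*} [Fintype G] [LinearOrder G] (Φ : CurveSystem G)
    (A : Finset V) (px py : V → ℝ)
    (hx : ∀ a ∈ A, Φ.xmin < px a ∧ px a < Φ.xmax)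
    (hy : ∀ a ∈ A, Φ.cv (Sum.inr false) (px a) < py a ∧ py a ≤ Φ.cv (Sum.inr true) (px a))
    (hd : ∀ a ∈ A, ∀ e e', e ≠ e' → Φ.cv e (px a) ≠ Φ.cv e' (px a))
    {q : ℝ} (hq0 : 0 < q) (hq1 : q ≤ 1 / 2) :
    ∃ (T : Finset (Trapezoid G)) (cell : V → Trapezoid G) (J : Trapezoid G → Finset G),
      (∀ a ∈ A, cell a ∈ T) ∧
      (∀ a ∈ A, ∀ a' ∈ A, cell a = cell a' → ∀ g, g ∉ J (cell a) →
        (py a ≤ Φ.cv (Sum.inl g) (px a) ↔ py a' ≤ Φ.cv (Sum.inl g) (px a'))) ∧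
      ∑ τ ∈ T, (1 + q) ^ (J τ).card ≤
        16 * (2 + 2 * Φ.K) * (1 + Fintype.card G * (2 * q)) ^ 2 := by
  classical
  have hex : ∀ (S : Finset G) (a : V), ∃ τ : Trapezoid G, a ∈ A → Φ.Valid τ ∧
      Φ.Mem τ (px a) (py a) ∧ (∀ g, τ.Defines g → g ∈ S) ∧ ∀ g ∈ S, ¬ Φ.Conflict τ g := by
    intro S a
    by_cases ha : a ∈ A
    · obtain ⟨τ, hτ⟩ := Φ.exists_trapezoid S (hx a ha).1 (hx a ha).2 (hy a ha).1 (hy a ha).2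
        (hd a ha)
      exact ⟨τ, fun _ => hτ⟩
    · exact ⟨⟨Sum.inr false, Sum.inr true, none, none, 0, 0⟩, fun h => absurd h ha⟩
  choose cell hcell using hex
  obtain ⟨U, hU⟩ : ∃ U, U = (Finset.univ : Finset (Finset G)).biUnion fun S => A.image (cell S) :=
    ⟨_, rfl⟩
  have hval : ∀ τ ∈ U, Φ.Valid τ := by
    intro τ hτ
    rw [hU] at hτ
    obtain ⟨S, _, hτ⟩ := Finset.mem_biUnion.1 hτ
    obtain ⟨a, ha, rfl⟩ := Finset.mem_image.1 hτ
    exact (hcell S a ha).1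
  obtain ⟨S, hS⟩ := exists_sample U Trapezoid.defining Φ.conflicts
    (fun τ _ => τ.card_defining_le) (by positivity) (card_filter_le U hval) hq0 hq1
  refine ⟨_, cell S, Φ.conflicts, fun a ha => ?_, fun a ha a' ha' haa g hg => ?_, hS⟩
  · obtain ⟨_, _, h1, h2⟩ := hcell S a ha
    refine Finset.mem_filter.2 ⟨?_, fun g hg => h1 g (Finset.mem_filter.1 hg).2, ?_⟩
    · rw [hU]
      exact Finset.mem_biUnion.2 ⟨S, Finset.mem_univ _, Finset.mem_image_of_mem _ ha⟩
    · exact Finset.disjoint_left.2 fun g hg hgS => h2 g hgS (Finset.mem_filter.1 hg).2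
  · refine le_iff_of_not_conflict (hcell S a ha).1
      (fun h => hg (Finset.mem_filter.2 ⟨Finset.mem_univ _, h⟩)) (hcell S a ha).2.1 ?_
    rw [haa]
    exact (hcell S a' ha').2.1

theorem exists_finset_quartic_roots {a b c d e : ℝ}
    (h : ¬ (a = 0 ∧ b = 0 ∧ c = 0 ∧ d = 0 ∧ e = 0)) :
    ∃ F : Finset ℝ, F.card ≤ 4 ∧
      ∀ x, a * x ^ 4 + b * x ^ 3 + c * x ^ 2 + d * x + e = 0 → x ∈ F := by
  classical
  obtain ⟨P, hP⟩ : ∃ P : Polynomial ℝ, P = Polynomial.C a * Polynomial.X ^ 4 +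
      Polynomial.C b * Polynomial.X ^ 3 + Polynomial.C c * Polynomial.X ^ 2 +
      Polynomial.C d * Polynomial.X + Polynomial.C e := ⟨_, rfl⟩
  have hne : P ≠ 0 := by
    intro h0
    have hc : ∀ n, P.coeff n = 0 := by simp [h0]
    apply h
    refine ⟨?_, ?_, ?_, ?_, ?_⟩
    · simpa [hP, Polynomial.coeff_X, Polynomial.coeff_C, Polynomial.coeff_X_pow] using hc 4
    · simpa [hP, Polynomial.coeff_X, Polynomial.coeff_C, Polynomial.coeff_X_pow] using hc 3
    · simpa [hP, Polynomial.coeff_X, Polynomial.coeff_C, Polynomial.coeff_X_pow] using hc 2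
    · simpa [hP, Polynomial.coeff_X, Polynomial.coeff_C, Polynomial.coeff_X_pow] using hc 1
    · simpa [hP, Polynomial.coeff_X, Polynomial.coeff_C, Polynomial.coeff_X_pow] using hc 0
  refine ⟨P.roots.toFinset, (Multiset.toFinset_card_le _).trans ((Polynomial.card_roots' P).trans ?_),
    fun x hx => ?_⟩
  · rw [hP]
    compute_degree
  · rw [Multiset.mem_toFinset, Polynomial.mem_roots hne, Polynomial.IsRoot, hP]
    simpa using hx

/-- The height of the upper half circle of radius `ρ` around `c`, continued outside the circle by
a downward parabola of opening `k`. -/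
noncomputable def arch (c ρ k x : ℝ) : ℝ :=
  √(ρ ^ 2 - (x - c) ^ 2) + k * min (ρ ^ 2 - (x - c) ^ 2) 0

theorem continuous_arch (c ρ k : ℝ) : Continuous (arch c ρ k) := by
  unfold arch
  fun_prop

theorem arch_spec (c ρ k x : ℝ) :
    (0 ≤ arch c ρ k x ∧ arch c ρ k x ^ 2 = ρ ^ 2 - (x - c) ^ 2) ∨
    (ρ ^ 2 - (x - c) ^ 2 < 0 ∧ arch c ρ k x = k * (ρ ^ 2 - (x - c) ^ 2)) := by
  unfold arch
  rcases le_or_gt 0 (ρ ^ 2 - (x - c) ^ 2) with h | h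
  · left
    rw [min_eq_right h, mul_zero, add_zero]
    exact ⟨Real.sqrt_nonneg _, Real.sq_sqrt h⟩
  · right
    rw [min_eq_left h.le, Real.sqrt_eq_zero_of_nonpos h.le, zero_add]
    exact ⟨h, rfl⟩

theorem mem_disk_iff {c ρ k x d y : ℝ} (hk : 0 < k) (hne : (x - c) ^ 2 + (y - d) ^ 2 ≠ ρ ^ 2) :
    (x - c) ^ 2 + (y - d) ^ 2 < ρ ^ 2 ↔
      ¬ y ≤ d + -1 * arch c ρ k x ∧ y ≤ d + 1 * arch c ρ k x := by
  rcases arch_spec c ρ k x with ⟨h0, h⟩ | ⟨h0, h⟩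
  · constructor
    · intro hlt
      have := abs_lt_of_sq_lt_sq (show (y - d) ^ 2 < arch c ρ k x ^ 2 by linarith) h0
      rw [abs_lt] at this
      exact ⟨by linarith [this.1], by linarith [this.2]⟩
    · rintro ⟨h1, h2⟩
      refine lt_of_le_of_ne ?_ hne
      have : (y - d) ^ 2 ≤ arch c ρ k x ^ 2 := sq_le_sq' (by linarith) (by linarith)
      linarith
  · have : arch c ρ k x < 0 := by
      rw [h]
      exact mul_neg_of_pos_of_neg hk h0
    exact ⟨fun hlt => by nlinarith [sq_nonneg (y - d)], fun h' => by linarith [h'.1, h'.2]⟩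

theorem exists_meeting_arc_arc {c d ρ c' d' ρ' : ℝ} (hρ : 0 < ρ) (hρ' : 0 < ρ')
    (hne : ¬ (c = c' ∧ d = d' ∧ ρ = ρ')) :
    ∃ F : Finset ℝ, F.card ≤ 4 ∧ ∀ x y, (y - d) ^ 2 = ρ ^ 2 - (x - c) ^ 2 →
      (y - d') ^ 2 = ρ' ^ 2 - (x - c') ^ 2 → x ∈ F := by
  by_cases hcd : c = c' ∧ d = d'
  · obtain ⟨rfl, rfl⟩ := hcd
    refine ⟨∅, by simp, fun x y h h' => absurd ?_ fun h => hne ⟨rfl, rfl, h⟩⟩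
    have : ρ ^ 2 = ρ' ^ 2 := by linarith
    exact (pow_left_inj₀ hρ.le hρ'.le (by norm_num)).1 this
  · obtain ⟨u, hu⟩ : ∃ u, u = 2 * (c' - c) := ⟨_, rfl⟩
    obtain ⟨v, hv⟩ : ∃ v, v = 2 * (d' - d) := ⟨_, rfl⟩
    obtain ⟨w, hw⟩ : ∃ w, w = ρ ^ 2 - ρ' ^ 2 + c' ^ 2 + d' ^ 2 - c ^ 2 - d ^ 2 := ⟨_, rfl⟩
    obtain ⟨F, hF, hF'⟩ := exists_finset_quartic_roots (a := 0) (b := 0) (c := v ^ 2 + u ^ 2)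
      (d := -2 * v ^ 2 * c - 2 * u * (w - v * d))
      (e := v ^ 2 * c ^ 2 + (w - v * d) ^ 2 - v ^ 2 * ρ ^ 2) (by
        rintro ⟨-, -, h, -⟩
        have h1 : u = 0 := by nlinarith [sq_nonneg u, sq_nonneg v]
        have h2 : v = 0 := by nlinarith [sq_nonneg u, sq_nonneg v]
        exact hcd ⟨by linarith, by linarith⟩)
    refine ⟨F, hF, fun x y h h' => hF' x ?_⟩
    have hlin : v * y = w - u * x := by rw [hu, hv, hw]; linarith
    have : v ^ 2 * ((x - c) ^ 2 + (y - d) ^ 2 - ρ ^ 2) = 0 := by rw [h]; ring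
    have e : w = v * y + u * x := by linarith
    rw [e]
    linear_combination this

theorem exists_meeting_arc_parabola {c d ρ c' d' ρ' k' : ℝ} (hk : k' ≠ 0) :
    ∃ F : Finset ℝ, F.card ≤ 4 ∧ ∀ x y, (y - d) ^ 2 = ρ ^ 2 - (x - c) ^ 2 →
      y - d' = k' * (ρ' ^ 2 - (x - c') ^ 2) → x ∈ F := by
  obtain ⟨m, hm⟩ : ∃ m, m = d' + k' * ρ' ^ 2 - k' * c' ^ 2 - d := ⟨_, rfl⟩
  obtain ⟨F, hF, hF'⟩ := exists_finset_quartic_roots (a := k' ^ 2) (b := -4 * k' ^ 2 * c')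
    (c := 1 + 4 * k' ^ 2 * c' ^ 2 - 2 * k' * m) (d := -2 * c + 4 * k' * c' * m)
    (e := c ^ 2 + m ^ 2 - ρ ^ 2) (fun h => hk (by simpa using h.1))
  refine ⟨F, hF, fun x y h h' => hF' x ?_⟩
  have hy : y - d = m + 2 * k' * c' * x - k' * x ^ 2 := by rw [hm]; linarith
  rw [hy] at h
  linear_combination h

theorem exists_meeting_parabola_parabola {c d ρ k c' d' ρ' k' : ℝ} (hk : k ≠ k') :
    ∃ F : Finset ℝ, F.card ≤ 4 ∧ ∀ x y, y - d = k * (ρ ^ 2 - (x - c) ^ 2) →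
      y - d' = k' * (ρ' ^ 2 - (x - c') ^ 2) → x ∈ F := by
  obtain ⟨F, hF, hF'⟩ := exists_finset_quartic_roots (a := 0) (b := 0) (c := k - k')
    (d := 2 * k' * c' - 2 * k * c)
    (e := d' - d + k' * (ρ' ^ 2 - c' ^ 2) - k * (ρ ^ 2 - c ^ 2))
    (fun h => hk (by linarith [h.2.2.1]))
  refine ⟨F, hF, fun x y h h' => hF' x ?_⟩
  linear_combination h - h'

theorem exists_meeting_arch {c d ρ k c' d' ρ' k' s s' : ℝ} (hρ : 0 < ρ) (hρ' : 0 < ρ')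
    (hk : 0 < k) (hk' : 0 < k') (hkk : k ≠ k') (hs : s ^ 2 = 1) (hs' : s' ^ 2 = 1)
    (hne : ¬ (c = c' ∧ d = d' ∧ ρ = ρ')) :
    ∃ F : Finset ℝ, F.card ≤ 16 ∧ ∀ x, d + s * arch c ρ k x = d' + s' * arch c' ρ' k' x → x ∈ F := by
  classical
  have hs0 : s ≠ 0 := by rintro rfl; norm_num at hs
  have hs0' : s' ≠ 0 := by rintro rfl; norm_num at hs'
  have hsk : s * k ≠ s' * k' := by
    intro h
    have : k ^ 2 = k' ^ 2 := by
      calc k ^ 2 = (s * k) ^ 2 := by rw [mul_pow, hs, one_mul]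
        _ = k' ^ 2 := by rw [h, mul_pow, hs', one_mul]
    exact hkk ((pow_left_inj₀ hk.le hk'.le (by norm_num)).1 this)
  obtain ⟨F₁, h₁, H₁⟩ := exists_meeting_arc_arc hρ hρ' hne
  obtain ⟨F₂, h₂, H₂⟩ := exists_meeting_arc_parabola (c := c) (d := d) (ρ := ρ) (c' := c')
    (d' := d') (ρ' := ρ') (mul_ne_zero hs0' hk'.ne')
  obtain ⟨F₃, h₃, H₃⟩ := exists_meeting_arc_parabola (c := c') (d := d') (ρ := ρ') (c' := c)
    (d' := d) (ρ' := ρ) (mul_ne_zero hs0 hk.ne')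
  obtain ⟨F₄, h₄, H₄⟩ := exists_meeting_parabola_parabola (c := c) (d := d) (ρ := ρ) (c' := c')
    (d' := d') (ρ' := ρ') hsk
  refine ⟨(F₁ ∪ F₂) ∪ (F₃ ∪ F₄), ?_, fun x hx => ?_⟩
  · have := Finset.card_union_le (F₁ ∪ F₂) (F₃ ∪ F₄)
    have := Finset.card_union_le F₁ F₂
    have := Finset.card_union_le F₃ F₄
    omega
  · obtain ⟨y, hy⟩ : ∃ y, y = d + s * arch c ρ k x := ⟨_, rfl⟩
    have e : y - d = s * arch c ρ k x := by rw [hy]; ring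
    have e' : y - d' = s' * arch c' ρ' k' x := by rw [hy, hx]; ring
    simp only [Finset.mem_union]
    rcases arch_spec c ρ k x with ⟨-, h⟩ | ⟨-, h⟩ <;>
      rcases arch_spec c' ρ' k' x with ⟨-, h'⟩ | ⟨-, h'⟩
    · exact Or.inl (Or.inl (H₁ x y (by rw [e, mul_pow, hs, one_mul, h])
        (by rw [e', mul_pow, hs', one_mul, h'])))
    · exact Or.inl (Or.inr (H₂ x y (by rw [e, mul_pow, hs, one_mul, h])
        (by rw [e', h', mul_assoc])))
    · exact Or.inr (Or.inl (H₃ x y (by rw [e', mul_pow, hs', one_mul, h'])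
        (by rw [e, h, mul_assoc])))
    · exact Or.inr (Or.inr (H₄ x y (by rw [e, h, mul_assoc]) (by rw [e', h', mul_assoc])))

theorem exists_meeting_arch_self {c d ρ k s s' : ℝ} (hk : 0 < k) (hs : s ≠ s') :
    ∃ F : Finset ℝ, F.card ≤ 16 ∧ ∀ x, d + s * arch c ρ k x = d + s' * arch c ρ k x → x ∈ F := by
  obtain ⟨F, hF, hF'⟩ := exists_finset_quartic_roots (a := 0) (b := 0) (c := -1) (d := 2 * c)
    (e := ρ ^ 2 - c ^ 2) (fun h => by norm_num at h)
  refine ⟨F, hF.trans (by norm_num), fun x hx => hF' x ?_⟩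
  have h0 : arch c ρ k x = 0 := by
    have : (s - s') * arch c ρ k x = 0 := by linarith
    exact (mul_eq_zero.1 this).resolve_left (sub_ne_zero.2 hs)
  rcases arch_spec c ρ k x with ⟨-, h⟩ | ⟨h1, h⟩
  · rw [h0] at h
    linarith
  · rw [h0] at h
    exact absurd h.symm (mul_neg_of_pos_of_neg hk h1).ne

/-- The boundary curves of a finite family of distinct disks. -/
theorem exists_disk_curveSystem {ι : Type*} [Fintype ι] (c d ρ : ι → ℝ) (hρ : ∀ i, 0 < ρ i)
    (hinj : ∀ i j, c i = c j → d i = d j → ρ i = ρ j → i = j) :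
    ∃ (k : ι → ℝ) (Z : Finset ℝ), (∀ i, 0 < k i) ∧
      (∀ (i j : ι) (s t : Bool), (i, s) ≠ (j, t) → ∀ x,
        d i + (bif s then 1 else -1) * arch (c i) (ρ i) (k i) x =
          d j + (bif t then 1 else -1) * arch (c j) (ρ j) (k j) x → x ∈ Z) ∧
      ∀ (M X : ℝ), 0 ≤ M → ∃ Φ : CurveSystem (ι × Bool), Φ.K = 16 ∧ Φ.xmin = -X ∧ Φ.xmax = X ∧
        (∀ i s x, Φ.cv (Sum.inl (i, s)) x =
          d i + (bif s then 1 else -1) * arch (c i) (ρ i) (k i) x) ∧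
        (∀ x, Φ.cv (Sum.inr false) x < -M) ∧ ∀ x, M < Φ.cv (Sum.inr true) x := by
  classical
  obtain ⟨k, hk⟩ : ∃ k : ι → ℝ, k = fun i => ((Fintype.equivFin ι i : ℕ) : ℝ) + 1 := ⟨_, rfl⟩
  have hk0 : ∀ i, 0 < k i := fun i => by rw [hk]; positivity
  have hkinj : ∀ i j, i ≠ j → k i ≠ k j := by
    intro i j hij h
    rw [hk] at h
    have h1 : (Fintype.equivFin ι i : ℕ) = (Fintype.equivFin ι j : ℕ) := by
      have := add_right_cancel h
      exact_mod_cast this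
    exact hij ((Fintype.equivFin ι).injective (Fin.ext h1))
  obtain ⟨f, hf⟩ : ∃ f : ι × Bool → ℝ → ℝ, f = fun g x =>
      d g.1 + (bif g.2 then 1 else -1) * arch (c g.1) (ρ g.1) (k g.1) x := ⟨_, rfl⟩
  have hfc : ∀ g, Continuous (f g) := by
    intro g
    rw [hf]
    exact continuous_const.add (continuous_const.mul (continuous_arch _ _ _))
  have hsq : ∀ s : Bool, (bif s then (1 : ℝ) else -1) ^ 2 = 1 := by
    intro s; cases s <;> simp
  have hF : ∀ g h : ι × Bool, ∃ F : Finset ℝ, F.card ≤ 16 ∧ (g ≠ h → ∀ x, f g x = f h x → x ∈ F) := by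
    rintro ⟨i, s⟩ ⟨j, t⟩
    by_cases hne : (i, s) = (j, t)
    · exact ⟨∅, by simp, fun h => absurd hne h⟩
    rw [hf]
    by_cases hij : i = j
    · subst hij
      have hst : (bif s then (1 : ℝ) else -1) ≠ bif t then 1 else -1 := by
        cases s <;> cases t <;> simp at hne <;> norm_num
      obtain ⟨F, h1, h2⟩ := exists_meeting_arch_self (c := c i) (d := d i) (ρ := ρ i) (hk0 i) hst
      exact ⟨F, h1, fun _ => h2⟩
    · obtain ⟨F, h1, h2⟩ := exists_meeting_arch (c := c i) (d := d i) (c' := c j) (d' := d j)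
        (hρ i) (hρ j) (hk0 i) (hk0 j) (hkinj i j hij) (hsq s) (hsq t)
        (fun h => hij (hinj i j h.1 h.2.1 h.2.2))
      exact ⟨F, h1, fun _ => h2⟩
  choose F hFc hFm using hF
  refine ⟨k, Finset.univ.biUnion fun g => Finset.univ.biUnion fun h => F g h, hk0, ?_, ?_⟩
  · intro i j s t hne x hx
    simp only [Finset.mem_biUnion, Finset.mem_univ, true_and]
    refine ⟨(i, s), (j, t), hFm _ _ hne x ?_⟩
    rw [hf]
    exact hx
  · intro M X hM
    obtain ⟨N, hN⟩ : ∃ N : ℝ → ℝ, N = fun x => M + 1 + ∑ g, |f g x| := ⟨_, rfl⟩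
    have hNc : Continuous N := by
      rw [hN]
      exact continuous_const.add (continuous_finsetSum _ fun g _ => (hfc g).abs)
    have hNM : ∀ x, M < N x := by
      intro x
      have : 0 ≤ ∑ g, |f g x| := Finset.sum_nonneg fun g _ => abs_nonneg _
      rw [hN]
      dsimp only
      linarith
    have hNf : ∀ g x, |f g x| < N x := by
      intro g x
      have := Finset.single_le_sum (f := fun g => |f g x|) (fun g _ => abs_nonneg _)
        (Finset.mem_univ g)
      rw [hN]
      dsimp only at this ⊢
      linarith
    refine ⟨{
      cv := Sum.elim f fun e => bif e then N else -N
      xmin := -X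
      xmax := X
      K := 16
      meeting := fun g => Sum.elim (F g) fun _ => ∅
      continuous_cv := ?_
      lo_lt := ?_
      lt_hi := ?_
      mem_meeting := ?_
      card_meeting := ?_ }, rfl, rfl, rfl, fun i s x => ?_, fun x => ?_, hNM⟩
    · rintro (g | _ | _)
      · exact hfc g
      · exact hNc.neg
      · exact hNc
    · rintro (g | _ | _) h x
      · exact (abs_lt.1 (hNf g x)).1
      · exact absurd rfl h
      · show -N x < N x
        linarith [hNM x]
    · rintro (g | _ | _) h x
      · exact (abs_lt.1 (hNf g x)).2
      · show -N x < N x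
        linarith [hNM x]
      · exact absurd rfl h
    · rintro g (h | _ | _) x hne hx
      · exact hFm g h (fun e => hne (congrArg _ e)) x hx
      · exact absurd hx (abs_lt.1 (hNf g x)).1.ne'
      · exact absurd hx (abs_lt.1 (hNf g x)).2.ne
    · rintro g (h | _)
      · exact hFc g h
      · simp
    · exact congrFun (congrFun hf (i, s)) x
    · show -N x < -M
      linarith [hNM x]

/-- Points may be moved horizontally off a finite set without crossing any of finitely many
circles. -/
theorem exists_perturbation {ι V : Type*} [Fintype ι] (c d ρ : ι → ℝ) (Z : Finset ℝ)
    (A : Finset V) (X Y : V → ℝ)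
    (hne : ∀ a ∈ A, ∀ i, (X a - c i) ^ 2 + (Y a - d i) ^ 2 ≠ ρ i ^ 2) :
    ∃ ε : ℝ, ∀ a ∈ A, X a + ε ∉ Z ∧ ∀ i,
      (X a + ε - c i) ^ 2 + (Y a - d i) ^ 2 ≠ ρ i ^ 2 ∧
      ((X a + ε - c i) ^ 2 + (Y a - d i) ^ 2 < ρ i ^ 2 ↔
        (X a - c i) ^ 2 + (Y a - d i) ^ 2 < ρ i ^ 2) := by
  have h : ∀ᶠ ε : ℝ in nhdsWithin 0 {0}ᶜ, ∀ a ∈ A, (∀ z ∈ Z, X a + ε ≠ z) ∧ ∀ i,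
      (X a + ε - c i) ^ 2 + (Y a - d i) ^ 2 ≠ ρ i ^ 2 ∧
      ((X a + ε - c i) ^ 2 + (Y a - d i) ^ 2 < ρ i ^ 2 ↔
        (X a - c i) ^ 2 + (Y a - d i) ^ 2 < ρ i ^ 2) := by
    rw [Filter.eventually_all_finset]
    intro a ha
    refine Filter.Eventually.and ?_ ?_
    · rw [Filter.eventually_all_finset]
      intro z _
      by_cases hz : z = X a
      · filter_upwards [self_mem_nhdsWithin] with ε hε h
        exact hε (by rw [Set.mem_singleton_iff]; linarith)
      · have hc : Filter.Tendsto (fun ε => X a + ε) (nhds 0) (nhds (X a)) := by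
          have : Continuous fun ε => X a + ε := by fun_prop
          simpa using this.tendsto 0
        exact (hc.eventually_ne (Ne.symm hz)).filter_mono nhdsWithin_le_nhds
    · rw [Filter.eventually_all]
      intro i
      have hc : Filter.Tendsto (fun ε => (X a + ε - c i) ^ 2 + (Y a - d i) ^ 2) (nhds 0)
          (nhds ((X a - c i) ^ 2 + (Y a - d i) ^ 2)) := by
        have : Continuous fun ε => (X a + ε - c i) ^ 2 + (Y a - d i) ^ 2 := by fun_prop
        simpa using this.tendsto 0
      refine Filter.Eventually.filter_mono nhdsWithin_le_nhds ?_
      rcases (hne a ha i).lt_or_gt with h | h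
      · filter_upwards [hc.eventually_lt_const h] with ε hε
        exact ⟨hε.ne, iff_of_true hε h⟩
      · filter_upwards [hc.eventually_const_lt h] with ε hε
        exact ⟨hε.ne', iff_of_false hε.not_gt h.not_gt⟩
  obtain ⟨ε, hε⟩ := h.exists
  exact ⟨ε, fun a ha => ⟨fun hz => (hε a ha).1 _ hz rfl, (hε a ha).2⟩⟩

theorem exists_disk_cutting {ι V : Type*} [Fintype ι] (c d ρ : ι → ℝ) (hρ : ∀ i, 0 < ρ i)
    (hinj : ∀ i j, c i = c j → d i = d j → ρ i = ρ j → i = j) (A : Finset V) (X Y : V → ℝ)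
    (hne : ∀ a ∈ A, ∀ i, (X a - c i) ^ 2 + (Y a - d i) ^ 2 ≠ ρ i ^ 2)
    {q : ℝ} (hq0 : 0 < q) (hq1 : q ≤ 1 / 2) :
    ∃ (T : Finset (Trapezoid (ι × Bool))) (cell : V → Trapezoid (ι × Bool))
      (J : Trapezoid (ι × Bool) → Finset ι),
      (∀ a ∈ A, cell a ∈ T) ∧
      (∀ a ∈ A, ∀ a' ∈ A, cell a = cell a' → ∀ i, i ∉ J (cell a) →
        ((X a - c i) ^ 2 + (Y a - d i) ^ 2 < ρ i ^ 2 ↔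
          (X a' - c i) ^ 2 + (Y a' - d i) ^ 2 < ρ i ^ 2)) ∧
      ∑ τ ∈ T, (1 + q) ^ (J τ).card ≤ 544 * (1 + 4 * Fintype.card ι * q) ^ 2 := by
  classical
  obtain ⟨k, Z, hk, hZ, hΦ⟩ := exists_disk_curveSystem c d ρ hρ hinj
  obtain ⟨ε, hε⟩ := exists_perturbation c d ρ Z A X Y hne
  obtain ⟨Φ, hK, hmin, hmax, hcv, hlo, hhi⟩ := hΦ (∑ a ∈ A, |Y a|) (1 + ∑ a ∈ A, |X a + ε|)
    (Finset.sum_nonneg fun _ _ => abs_nonneg _)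
  have hXa : ∀ a ∈ A, |X a + ε| ≤ ∑ a ∈ A, |X a + ε| := fun a ha =>
    Finset.single_le_sum (f := fun a => |X a + ε|) (fun _ _ => abs_nonneg _) ha
  have hYa : ∀ a ∈ A, |Y a| ≤ ∑ a ∈ A, |Y a| := fun a ha =>
    Finset.single_le_sum (f := fun a => |Y a|) (fun _ _ => abs_nonneg _) ha
  let _ : LinearOrder (ι × Bool) :=
    LinearOrder.lift' (Fintype.equivFin (ι × Bool)) (Fintype.equivFin (ι × Bool)).injective
  obtain ⟨T, cell, J, h1, h2, h3⟩ := Φ.exists_cutting A (fun a => X a + ε) Y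
    (fun a ha => by
      have := abs_le.1 (hXa a ha)
      rw [hmin, hmax]
      exact ⟨by linarith [this.1], by linarith [this.2]⟩)
    (fun a ha => by
      have := abs_le.1 (hYa a ha)
      exact ⟨by linarith [this.1, hlo (X a + ε)], by linarith [this.2, hhi (X a + ε)]⟩)
    (fun a ha e e' hee h => by
      rcases e with ⟨i, s⟩ | _ | _
      · rcases e' with ⟨j, t⟩ | _ | _
        · rw [hcv, hcv] at h
          exact (hε a ha).1 (hZ i j s t (fun h => hee (congrArg _ h)) _ h)
        · exact (Φ.lo_lt _ hee _).ne' h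
        · exact (Φ.lt_hi _ hee _).ne h
      · exact (Φ.lo_lt _ hee.symm _).ne h
      · exact (Φ.lt_hi _ hee.symm _).ne' h)
    hq0 hq1
  refine ⟨T, cell, fun τ => (J τ).image Prod.fst, h1, fun a ha a' ha' haa i hi => ?_, ?_⟩
  · have hnot : ∀ s, (i, s) ∉ J (cell a) := fun s hs =>
      hi (Finset.mem_image.2 ⟨(i, s), hs, rfl⟩)
    have hm := h2 a ha a' ha' haa (i, false) (hnot _)
    have hp := h2 a ha a' ha' haa (i, true) (hnot _)
    rw [hcv, hcv] at hm hp
    rw [← ((hε a ha).2 i).2, ← ((hε a' ha').2 i).2, mem_disk_iff (hk i) ((hε a ha).2 i).1,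
      mem_disk_iff (hk i) ((hε a' ha').2 i).1]
    exact and_congr (not_congr hm) hp
  · calc ∑ τ ∈ T, (1 + q) ^ ((J τ).image Prod.fst).card ≤ ∑ τ ∈ T, (1 + q) ^ (J τ).card :=
          Finset.sum_le_sum fun τ _ => pow_le_pow_right₀ (by linarith) Finset.card_image_le
      _ ≤ _ := h3
      _ = _ := by
        rw [hK, Fintype.card_prod, Fintype.card_bool]
        push_cast
        ring

theorem exists_between_of_finset (F : Finset ℝ) {α β : ℝ} (h : α < β) :
    ∃ x, α < x ∧ x < β ∧ ∀ d ∈ F, d ≠ x ∧ (d < x ↔ d ≤ α) := by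
  have hev : ∀ᶠ x in nhdsWithin α (Set.Ioi α), ∀ d ∈ F, d ≠ x ∧ (d < x ↔ d ≤ α) := by
    rw [Filter.eventually_all_finset]
    intro d _
    rcases le_or_gt d α with hd | hd
    · filter_upwards [self_mem_nhdsWithin] with x hx
      have : d < x := hd.trans_lt hx
      exact ⟨this.ne, iff_of_true this hd⟩
    · filter_upwards [Ioo_mem_nhdsGT hd] with x hx
      exact ⟨hx.2.ne', iff_of_false hx.2.not_gt hd.not_ge⟩
  obtain ⟨x, hx, hx'⟩ := (hev.and (Ioo_mem_nhdsGT h)).exists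
  exact ⟨x, hx'.1, hx'.2, hx⟩

theorem sq_le_mul_one_add_pow {q : ℝ} (h0 : 0 < q) (h1 : q ≤ 1) (x : ℕ) :
    (x : ℝ) ^ 2 ≤ 9 / q ^ 2 * (1 + q) ^ x := by
  have e1 : 1 + (x : ℝ) * (q / 3) ≤ (1 + q / 3) ^ x :=
    one_add_mul_le_pow (by linarith) x
  have e2 : ((1 + q / 3) ^ x) ^ 2 ≤ (1 + q) ^ x := by
    rw [← pow_mul, mul_comm x 2, pow_mul]
    exact pow_le_pow_left₀ (by positivity) (by nlinarith) x
  have e3 : ((x : ℝ) * (q / 3)) ^ 2 ≤ ((1 + q / 3) ^ x) ^ 2 :=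
    pow_le_pow_left₀ (by positivity) (by linarith) 2
  calc (x : ℝ) ^ 2 = 9 / q ^ 2 * ((x : ℝ) * (q / 3)) ^ 2 := by
        field_simp
        norm_num
    _ ≤ 9 / q ^ 2 * (1 + q) ^ x := by
      gcongr
      exact e3.trans e2

theorem natCast_le_of_one_add_pow_le {q r : ℝ} (h0 : 0 < q) (h1 : q ≤ 1) (hr : 1 ≤ r) {x : ℕ}
    (h : (1 + q) ^ x ≤ 2176 * r ^ 2) : (x : ℝ) ≤ 16 / q * (1 + Real.log r) := by
  have hlr : 0 ≤ Real.log r := Real.log_nonneg hr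
  have e1 : Real.log ((1 + q) ^ x) ≤ Real.log (2176 * r ^ 2) := Real.log_le_log (by positivity) h
  rw [Real.log_pow, Real.log_mul (by norm_num) (by positivity), Real.log_pow] at e1
  have e2 : q / 2 ≤ Real.log (1 + q) := by
    refine le_trans ?_ (Real.le_log_one_add_of_nonneg h0.le)
    rw [div_le_div_iff₀ (by norm_num) (by linarith)]
    nlinarith
  have e3 : Real.log 2176 ≤ 8 := by
    rw [Real.log_le_iff_le_exp (by norm_num)]
    calc (2176 : ℝ) ≤ 2.7 ^ 8 := by norm_num
      _ ≤ Real.exp 1 ^ 8 := by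
        gcongr
        linarith [Real.exp_one_gt_d9]
      _ = Real.exp 8 := by rw [← Real.exp_nat_mul]; norm_num
  have e4 : (x : ℝ) * (q / 2) ≤ 8 * (1 + Real.log r) := by
    have : (x : ℝ) * (q / 2) ≤ x * Real.log (1 + q) := by gcongr
    push_cast at e1
    linarith
  calc (x : ℝ) = 2 / q * (x * (q / 2)) := by field_simp
    _ ≤ 2 / q * (8 * (1 + Real.log r)) := by gcongr
    _ = 16 / q * (1 + Real.log r) := by ring

theorem Pt.dist_lt_iff (a b : Pt) {x : ℝ} (hx : 0 < x) :
    dist a b < x ↔ (a 0 - b 0) ^ 2 + (a 1 - b 1) ^ 2 < x ^ 2 := by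
  rw [EuclideanSpace.dist_eq, Real.sqrt_lt' hx, Fin.sum_univ_two, Real.dist_eq, Real.dist_eq,
    sq_abs, sq_abs]

theorem Pt.dist_eq_of_sq (a b : Pt) {x : ℝ} (hx : 0 < x)
    (h : (a 0 - b 0) ^ 2 + (a 1 - b 1) ^ 2 = x ^ 2) : dist a b = x := by
  rw [EuclideanSpace.dist_eq, Fin.sum_univ_two, Real.dist_eq, Real.dist_eq,
    sq_abs, sq_abs, h, Real.sqrt_sq hx.le]

theorem hasCuttings_dist_mem_Ioc [DecidableEq Pt] {α β : ℝ} (hα : 0 ≤ α) (hαβ : α < β) :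
    HasCuttings (fun a b : Pt => dist a b ∈ Set.Ioc α β) 1253376 := by
  classical
  intro A B r hr hrB
  obtain ⟨α', hα1, hα2, hα3⟩ := exists_between_of_finset
    (Finset.image₂ (fun a b : Pt => dist a b) A B) hαβ
  obtain ⟨β', hβ1, -, hβ3⟩ := exists_between_of_finset
    (Finset.image₂ (fun a b : Pt => dist a b) A B) (lt_add_one β)
  obtain ⟨ρ, hρ⟩ : ∃ ρ : Bool → ℝ, ρ = fun s => bif s then β' else α' := ⟨_, rfl⟩
  have hρ0 : ∀ s, 0 < ρ s := by
    intro s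
    rw [hρ]
    cases s
    · show 0 < α'
      linarith
    · show 0 < β'
      linarith
  have hρinj : ∀ s t, ρ s = ρ t → s = t := by
    intro s t
    rw [hρ]
    cases s <;> cases t <;> simp <;> intro h <;> linarith
  have hρne : ∀ a ∈ A, ∀ b ∈ B, ∀ s, dist a b ≠ ρ s := by
    intro a ha b hb s
    rw [hρ]
    cases s
    · exact (hα3 _ (Finset.mem_image₂_of_mem ha hb)).1
    · exact (hβ3 _ (Finset.mem_image₂_of_mem ha hb)).1
  have hrel : ∀ a ∈ A, ∀ b ∈ B, dist a b ∈ Set.Ioc α β ↔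
      ¬ dist a b < ρ false ∧ dist a b < ρ true := by
    intro a ha b hb
    rw [hρ]
    show _ ↔ ¬ dist a b < α' ∧ dist a b < β'
    rw [(hα3 _ (Finset.mem_image₂_of_mem ha hb)).2, (hβ3 _ (Finset.mem_image₂_of_mem ha hb)).2,
      not_le, Set.mem_Ioc]
  have hn : (0 : ℝ) < B.card := by linarith
  obtain ⟨q, hq⟩ : ∃ q, q = r / (8 * B.card) := ⟨_, rfl⟩
  have hq0 : 0 < q := by rw [hq]; positivity
  have hq1 : q ≤ 1 / 8 := by
    rw [hq, div_le_div_iff₀ (by positivity) (by norm_num)]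
    linarith
  obtain ⟨T, cell, J, h1, h2, h3⟩ := exists_disk_cutting (ι := B × Bool) (fun i => i.1.1 0)
    (fun i => i.1.1 1) (fun i => ρ i.2) (fun i => hρ0 i.2)
    (by
      rintro ⟨⟨b, hb⟩, s⟩ ⟨⟨b', hb'⟩, t⟩ h h' h''
      have : b = b' := by
        ext i
        fin_cases i
        · exact h
        · exact h'
      subst this
      rw [hρinj s t h''])
    A (fun a => a 0) (fun a => a 1)
    (fun a ha i h => hρne a ha i.1 i.1.2 i.2 (Pt.dist_eq_of_sq a i.1 (hρ0 i.2) h)) hq0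
    (by linarith)
  have hcard : (Fintype.card (B × Bool) : ℝ) = 2 * B.card := by
    rw [Fintype.card_prod, Fintype.card_bool, Fintype.card_coe]
    push_cast
    ring
  have h4 : ∑ τ ∈ T, (1 + q) ^ (J τ).card ≤ 2176 * r ^ 2 := by
    refine h3.trans ?_
    have : 4 * (Fintype.card (B × Bool) : ℝ) * q = r := by
      rw [hcard, hq]
      field_simp
      norm_num
    rw [this]
    nlinarith
  have hrep : ∀ τ, ∃ a', ∀ a ∈ A, cell a = τ → a' ∈ A ∧ cell a' = τ := by
    intro τ
    by_cases h : ∃ a ∈ A, cell a = τ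
    · obtain ⟨a, ha⟩ := h
      exact ⟨a, fun _ _ _ => ha⟩
    · exact ⟨0, fun a ha hτ => absurd ⟨a, ha, hτ⟩ h⟩
  choose rep hrep using hrep
  have hpar : ∀ a ∈ A, rep (cell a) ∈ A ∧ cell (rep (cell a)) = cell a :=
    fun a ha => hrep _ a ha rfl
  have hI : ∀ τ, ((((J τ).image fun i => (i.1.1 : Pt)).card : ℕ) : ℝ) ≤ (J τ).card :=
    fun τ => by exact_mod_cast Finset.card_image_le
  have himg : ∀ τ ∈ A.image fun a => rep (cell a), cell τ ∈ T ∧ rep (cell τ) = τ := by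
    intro τ hτ
    obtain ⟨a, ha, rfl⟩ := Finset.mem_image.1 hτ
    have := hpar a ha
    exact ⟨h1 _ this.1, by rw [this.2]⟩
  have hsum : ∀ φ : Trapezoid ((B × Bool) × Bool) → ℝ, (∀ τ, 0 ≤ φ τ) →
      ∑ x ∈ A.image (fun a => rep (cell a)), φ (cell x) ≤ ∑ τ ∈ T, φ τ := by
    intro φ hφ
    rw [← Finset.sum_image (s := A.image fun a => rep (cell a)) (f := φ) (g := cell)]
    · refine Finset.sum_le_sum_of_subset_of_nonneg ?_ fun τ _ _ => hφ τ
      intro τ hτ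
      obtain ⟨x, hx, rfl⟩ := Finset.mem_image.1 hτ
      exact (himg x hx).1
    · intro x hx y hy hxy
      rw [← (himg x hx).2, ← (himg y hy).2, hxy]
  refine ⟨fun a => rep (cell a), fun x => (J (cell x)).image fun i => (i.1.1 : Pt),
    fun a ha => (hpar a ha).1, ?_, ?_, ?_, ?_, ?_⟩
  · intro x b hb
    obtain ⟨i, _, rfl⟩ := Finset.mem_image.1 hb
    exact i.1.2
  · intro a ha b hb hbI
    obtain ⟨hp1, hp2⟩ := hpar a ha
    have key : ∀ s, dist a b < ρ s ↔ dist (rep (cell a)) b < ρ s := by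
      intro s
      rw [Pt.dist_lt_iff _ _ (hρ0 s), Pt.dist_lt_iff _ _ (hρ0 s)]
      refine h2 a ha _ hp1 hp2.symm (⟨b, hb⟩, s) fun hJ => hbI ?_
      refine Finset.mem_image.2 ⟨(⟨b, hb⟩, s), ?_, rfl⟩
      rwa [hp2]
    beta_reduce
    rw [hrel a ha b hb, hrel _ hp1 b hb, key, key]
  · calc ((A.image fun a => rep (cell a)).card : ℝ)
        = ∑ x ∈ A.image (fun a => rep (cell a)), (1 : ℝ) := by simp
      _ ≤ ∑ τ ∈ T, (1 : ℝ) := hsum (fun _ => 1) fun _ => zero_le_one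
      _ ≤ ∑ τ ∈ T, (1 + q) ^ (J τ).card :=
          Finset.sum_le_sum fun τ _ => one_le_pow₀ (by linarith)
      _ ≤ 2176 * r ^ 2 := h4
      _ ≤ 1253376 * r ^ 2 := by gcongr; norm_num
  · calc ∑ x ∈ A.image (fun a => rep (cell a)),
          (((J (cell x)).image fun i => (i.1.1 : Pt)).card : ℝ) ^ 2
        ≤ ∑ x ∈ A.image (fun a => rep (cell a)), ((J (cell x)).card : ℝ) ^ 2 := by
          gcongr with x _
          exact Finset.card_image_le
      _ ≤ ∑ τ ∈ T, ((J τ).card : ℝ) ^ 2 := hsum (fun τ => ((J τ).card : ℝ) ^ 2) fun τ => sq_nonneg _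
      _ ≤ ∑ τ ∈ T, 9 / q ^ 2 * (1 + q) ^ (J τ).card :=
          Finset.sum_le_sum fun τ _ => sq_le_mul_one_add_pow hq0 (by linarith) _
      _ = 9 / q ^ 2 * ∑ τ ∈ T, (1 + q) ^ (J τ).card := by rw [Finset.mul_sum]
      _ ≤ 9 / q ^ 2 * (2176 * r ^ 2) := by gcongr
      _ = 1253376 * (B.card : ℝ) ^ 2 := by
        rw [hq]
        field_simp
        norm_num
  · intro x hx
    have hle : (1 + q) ^ (J (cell x)).card ≤ 2176 * r ^ 2 :=
      (Finset.single_le_sum (f := fun τ => (1 + q) ^ (J τ).card) (fun τ _ => by positivity)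
        (himg x hx).1).trans h4
    have hlr : 0 ≤ Real.log r := Real.log_nonneg hr
    calc (((J (cell x)).image fun i => (i.1.1 : Pt)).card : ℝ) ≤ (J (cell x)).card := hI _
      _ ≤ 16 / q * (1 + Real.log r) := natCast_le_of_one_add_pow_le hq0 (by linarith) hr hle
      _ = 128 * (B.card / r) * (1 + Real.log r) := by
        rw [hq]
        field_simp
        norm_num
      _ ≤ 1253376 * (B.card / r) * (1 + Real.log r) := by gcongr; norm_num

theorem complete_brs_theorem :
    ∃ C : ℝ, C > 0 ∧
      ∀ (A B : Finset Pt) (m n : ℕ) (α β : ℝ),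
        A.card = m → B.card = n → 2 ≤ m → 2 ≤ n → 0 ≤ α → α < β →
        ∃ Gm : Finset (Finset Pt × Finset Pt),
          (∀ p ∈ Gm, p.1 ⊆ A ∧ p.2 ⊆ B) ∧
          (∀ p ∈ Gm, ∀ q ∈ Gm, p ≠ q → Disjoint (p.1 ×ˢ p.2) (q.1 ×ˢ q.2)) ∧
          (∀ p ∈ Gm, ∀ a ∈ p.1, ∀ b ∈ p.2, dist a b ∈ Set.Ioc α β) ∧
          (∀ a ∈ A, ∀ b ∈ B, dist a b ∈ Set.Ioc α β →
            ∃! p, p ∈ Gm ∧ a ∈ p.1 ∧ b ∈ p.2) ∧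
          (Gm.card : ℝ) ≤
            C ^ logStar ((m : ℝ) + (n : ℝ)) * (m : ℝ) ^ ((2 : ℝ) / 3) *
                (n : ℝ) ^ ((2 : ℝ) / 3) +
              C * ((m : ℝ) + (n : ℝ)) ∧
          (∑ p ∈ Gm, ((p.1.card : ℝ) + (p.2.card : ℝ))) ≤
            C ^ logStar ((m : ℝ) + (n : ℝ)) * (m : ℝ) ^ ((2 : ℝ) / 3) *
                (n : ℝ) ^ ((2 : ℝ) / 3) +
              C * ((m : ℝ) * Real.logb 2 (n : ℝ) + (n : ℝ) * Real.logb 2 (m : ℝ)) := by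
  classical
  obtain ⟨K, hK, H⟩ := HasCuttings.exists_cover_bound (C := 1253376) (by norm_num)
  refine ⟨K, hK, ?_⟩
  rintro A B m n α β rfl rfl hm hn hα hαβ
  obtain ⟨Γ, hdisj, hcov, hcard, hsize⟩ := H _ (hasCuttings_dist_mem_Ioc hα hαβ)
    (fun a b h => by rwa [dist_comm]) A B hm hn
  refine ⟨Γ.filter fun p => p.1.Nonempty ∧ p.2.Nonempty, ?_, ?_, ?_, ?_, ?_, ?_⟩
  · intro p hp
    obtain ⟨hp, ⟨a₀, ha₀⟩, ⟨b₀, hb₀⟩⟩ := Finset.mem_filter.1 hp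
    exact ⟨fun a ha => ((hcov a b₀).2 ⟨p, hp, ha, hb₀⟩).1,
      fun b hb => ((hcov a₀ b).2 ⟨p, hp, ha₀, hb⟩).2.1⟩
  · exact fun p hp q hq => hdisj p (Finset.mem_filter.1 hp).1 q (Finset.mem_filter.1 hq).1
  · exact fun p hp a ha b hb => ((hcov a b).2 ⟨p, (Finset.mem_filter.1 hp).1, ha, hb⟩).2.2
  · intro a ha b hb hab
    obtain ⟨p, hp, hpa, hpb⟩ := (hcov a b).1 ⟨ha, hb, hab⟩
    refine ⟨p, ⟨Finset.mem_filter.2 ⟨hp, ⟨a, hpa⟩, ⟨b, hpb⟩⟩, hpa, hpb⟩, ?_⟩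
    rintro p' ⟨hp', hpa', hpb'⟩
    by_contra hne
    have hmem : (a, b) ∈ p'.1 ×ˢ p'.2 := Finset.mem_product.2 ⟨hpa', hpb'⟩
    exact Finset.disjoint_left.1 (hdisj p' (Finset.mem_filter.1 hp').1 p hp hne) hmem
      (Finset.mem_product.2 ⟨hpa, hpb⟩)
  · have h1 : ((Γ.filter fun p => p.1.Nonempty ∧ p.2.Nonempty).card : ℝ) ≤ Γ.card := by
      exact_mod_cast Finset.card_filter_le _ _
    have h2 : 0 ≤ K * ((A.card : ℝ) + B.card) := by positivity
    linarith
  · exact (Finset.sum_le_sum_of_subset_of_nonneg (Finset.filter_subset _ _)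
      fun p _ _ => by positivity).trans hsize
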